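/- Let d > 1 be a cube-free integer of one of the following forms, where p is a prime ≡ 1 (mod 9), q, q₁, q₂, q₃ are pairwise distinct primes ≡ −1 (mod 9), and e, e₁, f₁, f₂, f₃ ∈ {1, 2}: (a) d = 3^{e} p^{e₁}; (b) d = p^{e₁} q^{f₁} ≡ ±1 (mod 9); (c) d = 3^{e} q₁^{f₁} q₂^{f₂}; (d) d = q₁^{f₁} q₂^{f₂} q₃^{f₃} ≡ ±1 (mod 9). Then rank(C_{k,3}^{(σ)}) = 2 for k = ℚ(∛d, ζ₃). -/

import Mathlib

open IntermediateField NumberField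
open scoped nonZeroDivisors

set_option synthInstance.maxHeartbeats 1000000
set_option maxHeartbeats 2000000

noncomputable section

instance : Fact (Nat.Prime 3) := ⟨by norm_num⟩

/-- A positive integer is cube-free if no prime cube divides it. -/
def IsCubeFree (d : ℕ) : Prop := ∀ p : ℕ, p.Prime → ¬ (p ^ 3 ∣ d)

/-- The primitive cube root of unity `ζ₃ = e^{2πi/3}`. -/
def zeta3 : ℂ := Complex.exp (2 * Real.pi * Complex.I / 3)

lemma zeta3_isPrimitiveRoot : IsPrimitiveRoot zeta3 3 := by
  simpa [zeta3] using Complex.isPrimitiveRoot_exp 3 (by norm_num)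

lemma isIntegral_zeta3 : IsIntegral ℚ zeta3 :=
  (zeta3_isPrimitiveRoot.isIntegral (by norm_num)).tower_top

/-- The real cube root of `d`, as a complex number. -/
def cbrt (d : ℕ) : ℂ := ((d : ℝ) ^ ((3 : ℝ)⁻¹) : ℝ)

lemma cbrt_pow_three (d : ℕ) : (cbrt d) ^ 3 = (d : ℂ) := by
  have h : ((d : ℝ) ^ ((3 : ℝ)⁻¹)) ^ (3 : ℕ) = (d : ℝ) := by
    rw [← Real.rpow_natCast ((d : ℝ) ^ ((3 : ℝ)⁻¹)) 3, ← Real.rpow_mul (by positivity)]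
    norm_num
  calc (cbrt d) ^ 3 = (((((d : ℝ) ^ ((3 : ℝ)⁻¹)) ^ (3:ℕ) : ℝ)) : ℂ) := by
        push_cast [cbrt]; ring
    _ = ((d : ℝ) : ℂ) := by rw [h]
    _ = (d : ℂ) := by norm_num

lemma isIntegral_cbrt (d : ℕ) : IsIntegral ℚ (cbrt d) := by
  have h : IsIntegral ℤ (cbrt d) := by
    refine ⟨Polynomial.X ^ 3 - Polynomial.C (d : ℤ), ?_, ?_⟩
    · exact Polynomial.monic_X_pow_sub_C _ (by norm_num)
    · simp [Polynomial.eval₂, cbrt_pow_three d]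
  exact h.tower_top

/-- `k = ℚ(∛d, ζ₃)`, the normal closure of the pure cubic field `ℚ(∛d)`,
realized as a subfield of `ℂ`. -/
def Kc (d : ℕ) : IntermediateField ℚ ℂ := ℚ⟮cbrt d, zeta3⟯

instance (d : ℕ) : NumberField (Kc d) where
  to_finiteDimensional := by
    apply IntermediateField.finiteDimensional_adjoin
    rintro x (rfl | rfl)
    · exact isIntegral_cbrt d
    · exact isIntegral_zeta3

lemma zeta3_mem (d : ℕ) : zeta3 ∈ Kc d :=
  IntermediateField.subset_adjoin _ _ (by simp)

lemma cbrt_mem (d : ℕ) : cbrt d ∈ Kc d :=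
  IntermediateField.subset_adjoin _ _ (by simp)

/-- `ζ₃` as an element of `k`. -/
def zetaK (d : ℕ) : Kc d := ⟨zeta3, zeta3_mem d⟩

/-- `∛d` as an element of `k`. -/
def cbrtK (d : ℕ) : Kc d := ⟨cbrt d, cbrt_mem d⟩

/-- `k₀ = ℚ(ζ₃)` realized as a subfield of `k`. -/
def k0S (d : ℕ) : IntermediateField ℚ (Kc d) := ℚ⟮zetaK d⟯

/-- `L = ℚ(∛d)` realized as a subfield of `k`. -/
def LS (d : ℕ) : IntermediateField ℚ (Kc d) := ℚ⟮cbrtK d⟯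

instance (d : ℕ) : NumberField ↥(k0S d) where
instance (d : ℕ) : NumberField ↥(LS d) where

/-- `ζ₃` as an element of `k₀ ⊆ k`. -/
def zetaK0 (d : ℕ) : ↥(k0S d) := ⟨zetaK d, IntermediateField.mem_adjoin_simple_self ℚ (zetaK d)⟩

/-- `∛d` as an element of `L ⊆ k`. -/
def cbrtL (d : ℕ) : ↥(LS d) := ⟨cbrtK d, IntermediateField.mem_adjoin_simple_self ℚ (cbrtK d)⟩

/-- The set of ideal classes of `k` fixed by the action of `σ` (ambiguous classes):
a class `c` is ambiguous if, whenever a nonzero ideal `I` represents `c`, the ideal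
`σ(I)` also represents `c`. -/
def ambiguousSet (d : ℕ) (σ : ↥(Kc d) ≃ₐ[ℚ] ↥(Kc d)) : Set (ClassGroup (𝓞 ↥(Kc d))) :=
  {c | ∀ I : (Ideal (𝓞 ↥(Kc d)))⁰, ClassGroup.mk0 I = c →
    ∀ J : (Ideal (𝓞 ↥(Kc d)))⁰,
      (J : Ideal (𝓞 ↥(Kc d))) = Ideal.map (RingOfIntegers.mapRingHom σ) (I : Ideal (𝓞 ↥(Kc d))) →
      ClassGroup.mk0 J = c}

/-- `C_{k,3}^{(σ)}`: the 3-group of ambiguous ideal classes of `k/k₀`, i.e. the subgroup of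
the 3-Sylow subgroup of the ideal class group of `k` consisting of the classes fixed by `σ`. -/
def ambiguousClassGroup (d : ℕ) (σ : ↥(Kc d) ≃ₐ[ℚ] ↥(Kc d)) :
    Subgroup (ClassGroup (𝓞 ↥(Kc d))) :=
  CommGroup.primaryComponent (ClassGroup (𝓞 ↥(Kc d))) 3 ⊓ Subgroup.closure (ambiguousSet d σ)

namespace Subgroup

variable {X J Y : Type*} [CommGroup X] [CommGroup J] [Group Y]

/-- The relative index of `B` in `A` splits along a homomorphism into the relative index of the
images and the relative index of the intersections with the kernel. -/
lemma relIndex_eq_map_mul_inf_ker (g : X →* Y) {A B : Subgroup X} (h : B ≤ A) :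
    B.relIndex A = (B.map g).relIndex (A.map g) * (B ⊓ g.ker).relIndex (A ⊓ g.ker) := by
  have h1 : B ≤ B ⊔ A ⊓ g.ker := le_sup_left
  have h2 : B ⊔ A ⊓ g.ker ≤ A := sup_le h inf_le_left
  rw [← relIndex_mul_relIndex B _ A h1 h2, mul_comm]
  congr 1
  · rw [← relIndex_comap, comap_map_eq, ← inf_relIndex_right (B ⊔ g.ker),
      sup_inf_assoc_of_le _ h, inf_comm g.ker]
  · rw [sup_comm, relIndex_sup_right, ← inf_relIndex_right]
    congr 1
    rw [← inf_assoc, inf_eq_left.mpr h]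

/-- Transfer of the relative index along a homomorphism whose kernel lies in the smaller group. -/
lemma relIndex_eq_map (g : X →* Y) {A B : Subgroup X} (h : B ≤ A) (hk : A ⊓ g.ker ≤ B) :
    B.relIndex A = (B.map g).relIndex (A.map g) := by
  have : B ⊓ g.ker = A ⊓ g.ker := le_antisymm (inf_le_inf_right _ h) (le_inf hk inf_le_right)
  rw [relIndex_eq_map_mul_inf_ker g h, this, relIndex_self, mul_one]

section Herbrand

variable {s ψ N : X →* X}

/-- The Herbrand quotient of a module of units: if `U` is stable under an automorphism `s` of
order three, with six fixed points and `(U : U ^ 3) = 27`, then the first cohomology of `U` is three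
times as large as the zeroth one. -/
lemma exists_herbrand_index (hs : ∀ x, s (s (s x)) = x) (hψ : ∀ x, ψ x = s x / x)
    (hN : ∀ x, N x = x * s x * s (s x)) {U : Subgroup X} (hsU : U.map s ≤ U)
    (hcube : (U.map (powMonoidHom 3)).relIndex U = 27)
    (hker : (powMonoidHom 3 : X →* X).ker ≤ U ⊓ N.ker)
    (hE : Nat.card ↥(U ⊓ ψ.ker) = 6) (hT : Nat.card ↥(U ⊓ N.ker ⊓ ψ.ker) = 3) :
    (U.map ψ).relIndex (U ⊓ N.ker) = 3 * (U.map N).relIndex (U ⊓ ψ.ker) ∧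
      (U.map N).relIndex (U ⊓ ψ.ker) ≠ 0 := by
  have hNψ : ∀ x, N (ψ x) = 1 := fun x ↦ by
    rw [hN, hψ, map_div, map_div, hs]
    rw [mul_comm (_ / _) (_ / _), div_mul_div_cancel, div_mul_div_cancel, div_self']
  have hψN : ∀ x, ψ (N x) = 1 := fun x ↦ by
    rw [hψ, hN, map_mul, map_mul, hs, div_eq_one, mul_comm, mul_assoc]
  have hsU' : ∀ x ∈ U, s x ∈ U := fun x hx ↦ hsU (mem_map_of_mem _ hx)
  have hψU : ∀ x ∈ U, ψ x ∈ U := fun x hx ↦ by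
    rw [hψ]; exact div_mem (hsU' x hx) hx
  have hNU : ∀ x ∈ U, N x ∈ U := fun x hx ↦ by
    rw [hN]; exact mul_mem (mul_mem hx (hsU' x hx)) (hsU' _ (hsU' x hx))
  set V := U ⊓ N.ker with hV
  have hVU : V ≤ U := inf_le_left
  have hψV : V.map ψ ≤ U.map ψ := map_mono hVU
  have hψUV : U.map ψ ≤ V := by
    rintro _ ⟨x, hx, rfl⟩
    exact ⟨hψU x hx, hNψ x⟩
  have hNUE : U.map N ≤ U ⊓ ψ.ker := by
    rintro _ ⟨x, hx, rfl⟩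
    exact ⟨hNU x hx, hψN x⟩
  -- `(U : V) = #N(U)`
  have e1 : V.relIndex U = Nat.card (U.map N) := by
    rw [hV, inf_comm, inf_relIndex_right, relIndex_ker]
  have hfin : Finite ↥(U ⊓ ψ.ker) := Nat.finite_of_card_ne_zero (by omega)
  have e2 : Nat.card (U.map N) * (U.map N).relIndex (U ⊓ ψ.ker) = 6 := by
    rw [← hE, ← relIndex_bot_left, ← relIndex_bot_left, relIndex_mul_relIndex _ _ _ bot_le hNUE]
  have e3 : V.relIndex U = (V.map ψ).relIndex (U.map ψ) * 2 := by
    rw [relIndex_eq_map_mul_inf_ker ψ hVU]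
    congr 1
    have := relIndex_mul_relIndex ⊥ (V ⊓ ψ.ker) (U ⊓ ψ.ker) bot_le (inf_le_inf_right _ hVU)
    rw [relIndex_bot_left, relIndex_bot_left, hT, hE] at this
    omega
  have e4 : (V.map (powMonoidHom 3)).relIndex V = 27 := by
    have a1 := relIndex_mul_relIndex (V.map (powMonoidHom 3)) V U
      (by rintro _ ⟨x, hx, rfl⟩; exact pow_mem hx 3) hVU
    have a2 := relIndex_mul_relIndex (V.map (powMonoidHom 3)) (U.map (powMonoidHom 3)) U
      (map_mono hVU) (by rintro _ ⟨x, hx, rfl⟩; exact pow_mem hx 3)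
    rw [← relIndex_eq_map _ hVU (inf_le_right.trans hker), hcube] at a2
    have hne : V.relIndex U ≠ 0 := by
      rw [e1]; intro h; rw [h] at e2; omega
    have : (V.map (powMonoidHom 3)).relIndex V * V.relIndex U = 27 * V.relIndex U := by
      rw [a1, ← a2, mul_comm]
    exact Nat.eq_of_mul_eq_mul_right (Nat.pos_of_ne_zero hne) this
  have e5 : (V.map ψ).map ψ = V.map (powMonoidHom 3) := by
    have key : ∀ x ∈ V, ψ (ψ x) = ((s x)⁻¹) ^ 3 := fun x hx ↦ by
      have h1 : x * s x * s (s x) = 1 := by rw [← hN]; exact hx.2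
      have h2 : s (s x) * x = (s x)⁻¹ := by
        rw [eq_inv_iff_mul_eq_one, ← h1, mul_assoc, mul_comm (s (s x))]
      rw [hψ, hψ, map_div, div_div_div_eq, h2, div_eq_mul_inv, mul_inv, pow_succ, pow_two,
        mul_assoc]
    have hsV : ∀ x ∈ V, s x ∈ V := fun x hx ↦ ⟨hsU' x hx.1, by
      have : x ∈ N.ker := hx.2
      change s x ∈ N.ker
      rw [MonoidHom.mem_ker, hN] at this ⊢
      rw [hs, ← this, mul_comm, mul_assoc]⟩
    apply le_antisymm
    · rintro _ ⟨_, ⟨x, hx, rfl⟩, rfl⟩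
      exact ⟨(s x)⁻¹, inv_mem (hsV x hx), (key x hx).symm⟩
    · rintro _ ⟨x, hx, rfl⟩
      have hy : (s (s x))⁻¹ ∈ V := inv_mem (hsV _ (hsV x hx))
      refine ⟨_, ⟨_, hy, rfl⟩, ?_⟩
      rw [key _ hy, map_inv, hs, inv_inv]; rfl
  have e6 := relIndex_mul_relIndex ((V.map ψ).map ψ) (V.map ψ) V
    (map_mono (hψV.trans hψUV)) (hψV.trans hψUV)
  rw [e5, e4] at e6
  have e7 := relIndex_eq_map_mul_inf_ker ψ (hψV.trans hψUV)
  rw [e5] at e7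
  have e8 : (V.map ψ ⊓ ψ.ker).relIndex (V ⊓ ψ.ker) ∣ 3 := by
    rw [← hT]; exact relIndex_dvd_card _ _
  have e9 := relIndex_mul_relIndex (V.map ψ) (U.map ψ) V hψV hψUV
  generalize (V.map ψ).relIndex V = c at *
  generalize (V.map (powMonoidHom 3)).relIndex (V.map ψ) = y at *
  generalize (V.map ψ ⊓ ψ.ker).relIndex (V ⊓ ψ.ker) = z at *
  generalize (V.map ψ).relIndex (U.map ψ) = m at *
  generalize (U.map N).relIndex (U ⊓ ψ.ker) = e at *
  generalize (U.map ψ).relIndex V = v at *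
  generalize Nat.card (U.map N) = n at *
  have hz : z = 1 ∨ z = 3 := (Nat.dvd_prime Nat.prime_three).mp e8
  have hc : c = 9 := by
    rcases hz with rfl | rfl
    · rw [mul_one] at e7; subst e7
      have : c ≤ 27 := by nlinarith
      interval_cases c <;> omega
    · subst e7
      have : y ≤ 9 := by nlinarith
      interval_cases y <;> omega
  subst hc
  have he : e ≠ 0 := by rintro rfl; omega
  refine ⟨?_, he⟩
  have h1 : m * e = 3 := by
    have : n = m * 2 := by omega
    subst this
    nlinarith
  have hm : m ≠ 0 := by rintro rfl; omega
  apply Nat.eq_of_mul_eq_mul_left (Nat.pos_of_ne_zero hm)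
  rw [e9]; linarith

/-- The ambiguous class number formula, in the case of three ramified primes and fixed units that
are all norms. -/
theorem relIndex_comap_range_eq_nine {sJ φ : J →* J} (hs : ∀ x, s (s (s x)) = x)
    (hsJ : ∀ x, sJ (sJ (sJ x)) = x)
    (hψ : ∀ x, ψ x = s x / x) (hφ : ∀ x, φ x = sJ x / x)
    (hN : ∀ x, N x = x * s x * s (s x)) {prin : X →* J} (hprin : ∀ x, prin (s x) = sJ (prin x))
    (hcube : (prin.ker.map (powMonoidHom 3)).relIndex prin.ker = 27)
    (hker : (powMonoidHom 3 : X →* X).ker ≤ prin.ker ⊓ N.ker)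
    (hE : Nat.card ↥(prin.ker ⊓ ψ.ker) = 6) (hT : Nat.card ↥(prin.ker ⊓ N.ker ⊓ ψ.ker) = 3)
    (h90 : ∀ x, N x = 1 → ∃ y, ψ y = x)
    (hnorm : ∀ x ∈ prin.ker, ψ x = 1 → ∃ y, N y = x)
    (hideal : ∀ x, N x ∈ prin.ker → ∃ I, φ I = prin x)
    (h27 : (ψ.ker.map prin).relIndex φ.ker = 27) :
    prin.range.relIndex (prin.range.comap φ) = 9 := by
  have hNψ : ∀ x, N (ψ x) = 1 := fun x ↦ by
    rw [hN, hψ, map_div, map_div, hs]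
    rw [mul_comm (_ / _) (_ / _), div_mul_div_cancel, div_mul_div_cancel, div_self']
  have hψN : ∀ x, ψ (N x) = 1 := fun x ↦ by
    rw [hψ, hN, map_mul, map_mul, hs, div_eq_one, mul_comm, mul_assoc]
  have hφprin : ∀ x, φ (prin x) = prin (ψ x) := fun x ↦ by rw [hφ, hψ, map_div, hprin]
  have hNφ : ∀ I x, φ I = prin x → prin (N x) = 1 := fun I x h ↦ by
    rw [hN, map_mul, map_mul, hprin, hprin, hprin, ← h, hφ, map_div, map_div, hsJ]
    rw [mul_comm (_ / _) (_ / _), div_mul_div_cancel, div_mul_div_cancel, div_self']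
  have hsU : prin.ker.map s ≤ prin.ker := by
    rintro _ ⟨x, hx, rfl⟩
    rw [MonoidHom.mem_ker, hprin, hx, map_one]
  obtain ⟨k1, k2⟩ := exists_herbrand_index hs hψ hN hsU hcube hker hE hT
  have hPD : prin.range ≤ prin.range.comap φ := by
    rintro _ ⟨x, rfl⟩
    exact ⟨ψ x, (hφprin x).symm⟩
  have hkD : φ.ker ≤ prin.range.comap φ := fun x hx ↦ by
    rw [mem_comap, hx]; exact one_mem _
  rw [relIndex_eq_map_mul_inf_ker φ hPD, inf_eq_right.mpr hkD]
  -- the fixed principal ideals modulo those generated by fixed elements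
  have hW : prin.range ⊓ φ.ker = (prin.ker.comap ψ).map prin := by
    ext I
    constructor
    · rintro ⟨⟨x, rfl⟩, hx⟩
      exact ⟨x, (hφprin x).symm.trans hx, rfl⟩
    · rintro ⟨x, hx, rfl⟩
      exact ⟨⟨x, rfl⟩, (hφprin x).trans hx⟩
  have hUW : prin.ker ≤ prin.ker.comap ψ := fun x hx ↦ by
    rw [mem_comap, MonoidHom.mem_ker, hψ, map_div, hprin, hx, map_one, div_one]
  have hkW : ψ.ker ≤ prin.ker.comap ψ := fun x hx ↦ by
    rw [mem_comap, hx]; exact one_mem _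
  have f1 : (ψ.ker.map prin).relIndex (prin.range ⊓ φ.ker) =
      (prin.ker.map ψ).relIndex (prin.ker ⊓ N.ker) := by
    have t1 := relIndex_eq_map prin (sup_le hkW hUW) (inf_le_right.trans le_sup_right)
    have t2 := relIndex_eq_map ψ (sup_le hkW hUW) (inf_le_right.trans le_sup_left)
    have u1 : (ψ.ker ⊔ prin.ker).map prin = ψ.ker.map prin := by
      rw [map_sup, (map_eq_bot_iff _).mpr le_rfl, sup_bot_eq]
    have u2 : (ψ.ker ⊔ prin.ker).map ψ = prin.ker.map ψ := by
      rw [map_sup, (map_eq_bot_iff _).mpr le_rfl, bot_sup_eq]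
    have u3 : (prin.ker.comap ψ).map ψ = prin.ker ⊓ N.ker := by
      ext x
      constructor
      · rintro ⟨y, hy, rfl⟩
        exact ⟨hy, hNψ y⟩
      · rintro ⟨h1, h2⟩
        obtain ⟨y, rfl⟩ := h90 x h2
        exact ⟨y, h1, rfl⟩
    rw [hW, ← u1, ← t1, t2, u2, u3]
  have f2 : (prin.range.map φ).relIndex ((prin.range.comap φ).map φ) =
      (prin.ker.map N).relIndex (prin.ker ⊓ ψ.ker) := by
    have hUY : prin.ker ≤ prin.ker.comap N := fun x hx ↦ by
      rw [mem_comap, MonoidHom.mem_ker, hN, map_mul, map_mul, hprin, hprin, hprin, hx]; simp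
    have hkY : N.ker ≤ prin.ker.comap N := fun x hx ↦ by
      rw [mem_comap, hx]; exact one_mem _
    have t1 := relIndex_eq_map prin (sup_le hkY hUY) (inf_le_right.trans le_sup_right)
    have t2 := relIndex_eq_map N (sup_le hkY hUY) (inf_le_right.trans le_sup_left)
    have u1 : (N.ker ⊔ prin.ker).map prin = prin.range.map φ := by
      rw [map_sup, (map_eq_bot_iff prin.ker).mpr le_rfl, sup_bot_eq]
      ext I
      constructor
      · rintro ⟨x, hx, rfl⟩
        obtain ⟨y, rfl⟩ := h90 x hx
        exact ⟨prin y, ⟨y, rfl⟩, hφprin y⟩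
      · rintro ⟨_, ⟨y, rfl⟩, rfl⟩
        exact ⟨ψ y, hNψ y, (hφprin y).symm⟩
    have u2 : (N.ker ⊔ prin.ker).map N = prin.ker.map N := by
      rw [map_sup, (map_eq_bot_iff _).mpr le_rfl, bot_sup_eq]
    have u3 : (prin.ker.comap N).map N = prin.ker ⊓ ψ.ker := by
      ext x
      constructor
      · rintro ⟨y, hy, rfl⟩
        exact ⟨hy, hψN y⟩
      · rintro ⟨h1, h2⟩
        obtain ⟨y, rfl⟩ := hnorm x h1 h2
        exact ⟨y, h1, rfl⟩
    have u4 : (prin.ker.comap N).map prin = (prin.range.comap φ).map φ := by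
      ext I
      constructor
      · rintro ⟨x, hx, rfl⟩
        obtain ⟨I, hI⟩ := hideal x hx
        exact ⟨I, ⟨x, hI.symm⟩, hI⟩
      · rintro ⟨I, ⟨x, hx⟩, rfl⟩
        exact ⟨x, hNφ I x hx.symm, hx⟩
    rw [← u1, ← u4, ← t1, t2, u2, u3]
  have f3 := relIndex_mul_relIndex (ψ.ker.map prin) (prin.range ⊓ φ.ker) φ.ker
    (by rw [hW]; exact map_mono hkW) inf_le_right
  rw [f1, k1, h27] at f3
  rw [f2]
  linarith

end Herbrand

end Subgroup

namespace NumberField.Units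

open Subgroup

variable (K : Type*) [Field K] [NumberField K]

/-- The index of the subgroup of `n`-th powers in a commutative group, in terms of a torsion
subgroup. -/
lemma _root_.Subgroup.index_range_powMonoidHom_eq_mul {X Q : Type*} [CommGroup X] [CommGroup Q]
    (g : X →* Q) (hg : Function.Surjective g) {n : ℕ} (hn : n ≠ 0)
    (hker : ∀ x, x ∈ g.ker ↔ IsOfFinOrder x) [Finite g.ker] :
    (powMonoidHom n : X →* X).range.index =
      (powMonoidHom n : Q →* Q).range.index * Nat.card (powMonoidHom n : X →* X).ker := by
  set f : X →* X := powMonoidHom n with hf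
  rw [← relIndex_top_right, relIndex_eq_map_mul_inf_ker g le_top, top_inf_eq]
  congr 1
  · have h1 : (⊤ : Subgroup X).map g = ⊤ := map_top_of_surjective _ hg
    have h2 : f.range.map g = (powMonoidHom n : Q →* Q).range := by
      ext x
      constructor
      · rintro ⟨_, ⟨y, rfl⟩, rfl⟩
        exact ⟨g y, (map_pow g y n).symm⟩
      · rintro ⟨y, rfl⟩
        obtain ⟨y, rfl⟩ := hg y
        exact ⟨_, ⟨y, rfl⟩, map_pow g y n⟩
    rw [h1, h2, relIndex_top_right]
  · have hk : f.ker ≤ g.ker := fun x hx ↦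
      (hker x).mpr (isOfFinOrder_iff_pow_eq_one.mpr ⟨n, by omega, hx⟩)
    have h1 : f.range ⊓ g.ker = g.ker.map f := by
      ext x
      constructor
      · rintro ⟨⟨y, rfl⟩, hy⟩
        have hy' : IsOfFinOrder (y ^ n) := (hker _).mp hy
        exact ⟨y, (hker y).mpr ((isOfFinOrder_pow.mp hy').resolve_right hn), rfl⟩
      · rintro ⟨y, hy, rfl⟩
        exact ⟨⟨y, rfl⟩, pow_mem hy n⟩
    have h2 : g.ker.map f ≤ g.ker := by rw [← h1]; exact inf_le_right
    have h3 := relIndex_eq_map_mul_inf_ker f (bot_le : ⊥ ≤ g.ker)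
    rw [inf_eq_right.mpr hk, bot_inf_eq, Subgroup.map_bot, relIndex_bot_left, relIndex_bot_left,
      relIndex_bot_left] at h3
    have h4 := relIndex_mul_relIndex ⊥ _ _ bot_le h2
    rw [relIndex_bot_left, relIndex_bot_left, h3] at h4
    rw [h1]
    have : Finite (g.ker.map f) := Finite.of_surjective (fun x : g.ker ↦
      (⟨f x, mem_map_of_mem f x.2⟩ : g.ker.map f)) (by
        rintro ⟨_, x, hx, rfl⟩; exact ⟨⟨x, hx⟩, rfl⟩)
    exact Nat.eq_of_mul_eq_mul_left Nat.card_pos h4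

/-- The index of the subgroup of `n`-th powers in the unit group of a number field. -/
lemma index_range_powMonoidHom {n : ℕ} (hn : n ≠ 0) :
    (powMonoidHom n : (𝓞 K)ˣ →* (𝓞 K)ˣ).range.index =
      n ^ rank K * Nat.card (powMonoidHom n : (𝓞 K)ˣ →* (𝓞 K)ˣ).ker := by
  have hker : (QuotientGroup.mk' (torsion K)).ker = torsion K := QuotientGroup.ker_mk' _
  have : Finite (QuotientGroup.mk' (torsion K)).ker := by rw [hker]; infer_instance
  rw [Subgroup.index_range_powMonoidHom_eq_mul (Q := (𝓞 K)ˣ ⧸ torsion K)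
      (QuotientGroup.mk' (torsion K)) (QuotientGroup.mk'_surjective _) hn
      (fun x ↦ by rw [hker]; rfl),
    ← finrank_modTorsion]
  congr 1
  exact AddSubgroup.index_range_nsmul (Additive ((𝓞 K)ˣ ⧸ torsion K)) n

end NumberField.Units

section InvariantIdeals

variable {A R : Type*} [CommRing A] [CommRing R] [Algebra A R]

/-- For an endomorphism of order three with fixed ring `A`, every element of an invariant ideal
inside an ideal lying over the prime `π` has its cube divisible by `π`. -/
lemma pow_three_mem_span_of_invariant (s : R →ₐ[A] R) (hs : ∀ x, s (s (s x)) = x)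
    (hfix : ∀ x, s x = x → ∃ a, algebraMap A R a = x) {π : A} {I Q : Ideal R}
    (hI : ∀ x ∈ I, s x ∈ I) (hIQ : I ≤ Q) (hQ : ∀ a, algebraMap A R a ∈ Q → π ∣ a) {x : R}
    (hx : x ∈ I) : x ^ 3 ∈ Ideal.span {algebraMap A R π} := by
  have h1 := hI x hx
  have h2 := hI _ h1
  have key : ∀ e ∈ I, s e = e → algebraMap A R π ∣ e := by
    intro e he hse
    obtain ⟨a, rfl⟩ := hfix e hse
    exact map_dvd _ (hQ a (hIQ he))
  have k1 := key (x + s x + s (s x)) (I.add_mem (I.add_mem hx h1) h2)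
    (by simp only [map_add, hs]; ring)
  have k2 := key (x * s x + s x * s (s x) + s (s x) * x)
    (I.add_mem (I.add_mem (I.mul_mem_right _ hx) (I.mul_mem_right _ h1)) (I.mul_mem_right _ h2))
    (by simp only [map_add, map_mul, hs]; ring)
  have k3 := key (x * s x * s (s x)) (I.mul_mem_left _ h2) (by simp only [map_mul, hs]; ring)
  rw [Ideal.mem_span_singleton]
  have : x ^ 3 = (x + s x + s (s x)) * x ^ 2 - (x * s x + s x * s (s x) + s (s x) * x) * x
    + x * s x * s (s x) := by ring
  rw [this]
  exact dvd_add (dvd_sub (k1.mul_right _) (k2.mul_right _)) k3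

/-- An element of the fixed ring divisible by `π` in `R` is divisible by `π` in `A`. -/
lemma dvd_of_algebraMap_dvd [IsDomain R] [FaithfulSMul A R] (s : R →ₐ[A] R)
    (hfix : ∀ x, s x = x → ∃ a, algebraMap A R a = x) {π a : A} (hπ : π ≠ 0)
    (h : algebraMap A R π ∣ algebraMap A R a) : π ∣ a := by
  obtain ⟨r, hr⟩ := h
  have hinj := FaithfulSMul.algebraMap_injective A R
  have h0 : algebraMap A R π ≠ 0 := fun h ↦ hπ (hinj (by simpa using h))
  have hsr : s r = r := by
    have := congrArg s hr
    rw [map_mul, s.commutes, s.commutes, hr] at this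
    exact (mul_left_cancel₀ h0 this).symm
  obtain ⟨b, rfl⟩ := hfix r hsr
  exact ⟨b, hinj (by rw [hr, map_mul])⟩

/-- If the discriminant of `y` is prime to `π`, then `π` generates a radical ideal of `R`. -/
lemma mem_span_of_pow_mem_of_isCoprime [IsDomain R] [FaithfulSMul A R] (s : R →ₐ[A] R)
    (hs : ∀ x, s (s (s x)) = x)
    (hfix : ∀ x, s x = x → ∃ a, algebraMap A R a = x) {π δ : A} (hπ : Prime π)
    (hδ : IsCoprime π δ) {y : R}
    (hy : (y - s y) * (s y - s (s y)) * (s (s y) - y) = algebraMap A R δ) {x : R} {n : ℕ}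
    (hx : x ^ n ∈ Ideal.span {algebraMap A R π}) : x ∈ Ideal.span {algebraMap A R π} := by
  set P := Ideal.span {algebraMap A R π} with hP
  have hPs : ∀ x ∈ P.radical, s x ∈ P.radical := by
    rintro x ⟨m, hm⟩
    refine ⟨m, ?_⟩
    rw [hP, Ideal.mem_span_singleton] at hm ⊢
    simpa using map_dvd s hm
  have h0 : x ∈ P.radical := ⟨n, hx⟩
  have h1 := hPs _ h0
  have h2 := hPs _ h1
  have key : ∀ e ∈ P.radical, s e = e → e ∈ P := by
    rintro e ⟨m, hm⟩ hse
    obtain ⟨a, rfl⟩ := hfix e hse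
    rw [hP, Ideal.mem_span_singleton] at hm ⊢
    rw [← map_pow] at hm
    exact map_dvd _ (hπ.dvd_of_dvd_pow (dvd_of_algebraMap_dvd s hfix hπ.ne_zero hm))
  have mem : ∀ a b c : R, x * a + s x * b + s (s x) * c ∈ P.radical := fun a b c ↦
    add_mem (add_mem (Ideal.mul_mem_right _ _ h0) (Ideal.mul_mem_right _ _ h1))
      (Ideal.mul_mem_right _ _ h2)
  have k1 := key _ (mem (s y - s (s y)) (s (s y) - y) (y - s y))
    (by simp only [map_add, map_mul, map_sub, hs]; ring)
  have k2 := key _ (mem (s y ^ 2 - s (s y) ^ 2) (s (s y) ^ 2 - y ^ 2) (y ^ 2 - s y ^ 2))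
    (by simp only [map_add, map_mul, map_sub, map_pow, hs]; ring)
  have k3 := key _ (mem ((s y - s (s y)) * s y * s (s y)) ((s (s y) - y) * s (s y) * y)
    ((y - s y) * y * s y)) (by simp only [map_add, map_mul, map_sub, hs]; ring)
  have hD : algebraMap A R δ * x ∈ P := by
    have := P.add_mem (P.sub_mem (P.mul_mem_left (-y) k2) (P.mul_mem_left (-y ^ 2) k1)) k3
    rw [← P.neg_mem_iff, ← hy]
    convert this using 1
    ring
  obtain ⟨u, v, huv⟩ := hδ
  have hxe : x = algebraMap A R π * (algebraMap A R u * x) +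
      algebraMap A R v * (algebraMap A R δ * x) := by
    have := congrArg (algebraMap A R) huv
    rw [map_add, map_mul, map_mul, map_one] at this
    linear_combination -x * this
  rw [hxe]
  exact P.add_mem (P.mul_mem_right _ (Ideal.mem_span_singleton_self _)) (P.mul_mem_left _ hD)

/-- Structure of invariant ideals for an automorphism of order three. -/
lemma exists_eq_span_mul_prod_of_invariant [IsDomain A] [IsPrincipalIdealRing A]
    [IsDedekindDomain R] [FaithfulSMul A R] [Algebra.IsIntegral A R] (s : R →ₐ[A] R)
    (hs : ∀ x, s (s (s x)) = x)
    (hfix : ∀ x, s x = x → ∃ a, algebraMap A R a = x) {ι : Type*} [Fintype ι] (π : ι → A)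
    (P : ι → Ideal R) (hPprime : ∀ i, (P i).IsPrime) (hP : ∀ i, P i ^ 3 = Ideal.span {algebraMap A R (π i)})
    (hPs : ∀ i, (P i).map s = P i)
    (hunr : ∀ q : A, Prime q → (∀ i, ¬ Associated q (π i)) → ∀ x : R, ∀ n : ℕ,
      x ^ n ∈ Ideal.span {algebraMap A R q} → x ∈ Ideal.span {algebraMap A R q})
    (I : Ideal R) (hI0 : I ≠ ⊥) (hI : I.map s = I) :
    ∃ a : A, ∃ n : ι → ℕ, I = Ideal.span {algebraMap A R a} * ∏ i, P i ^ n i := by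
  induction I using WellFoundedGT.induction with
  | ind I ih =>
    by_cases htop : I = ⊤
    · exact ⟨1, 0, by rw [htop, map_one, Ideal.span_singleton_one]; simp [← Ideal.one_eq_top]⟩
    obtain ⟨Q, hQ, hIQ⟩ := Ideal.exists_le_maximal I htop
    have hIs : ∀ x ∈ I, s x ∈ I := fun x hx ↦ hI ▸ Ideal.mem_map_of_mem s hx
    have hQ0 : Q ≠ ⊥ := fun h ↦ hI0 (le_bot_iff.mp (h ▸ hIQ))
    have hQA0 : Q.under A ≠ ⊥ := fun h ↦ hQ0 (Ideal.eq_bot_of_comap_eq_bot h)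
    obtain ⟨q, hq⟩ := (IsPrincipalIdealRing.principal (Q.under A)).principal
    change Q.under A = Ideal.span {q} at hq
    have hq0 : q ≠ 0 := fun h ↦ hQA0 (by rw [hq, h]; simp)
    have hqp : Prime q := by
      rw [← Ideal.span_singleton_prime hq0, ← hq]
      infer_instance
    have hQq : ∀ a, algebraMap A R a ∈ Q → q ∣ a := fun a ha ↦ by
      rw [← Ideal.mem_span_singleton, ← hq]; exact ha
    have hcube := fun x (hx : x ∈ I) ↦ pow_three_mem_span_of_invariant s hs hfix hIs hIQ hQq hx
    have step : ∀ T : Ideal R, T ≠ ⊥ → T ≠ ⊤ → T.map s = T → I ≤ T →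
        ∃ I', I = T * I' ∧ ∃ a : A, ∃ n : ι → ℕ, I' = Ideal.span {algebraMap A R a} * ∏ i, P i ^ n i := by
      intro T hT0 hT1 hTs hIT
      obtain ⟨I', rfl⟩ := Ideal.dvd_iff_le.mpr hIT
      have hI'0 : I' ≠ ⊥ := fun h ↦ hI0 (by rw [h, Ideal.mul_bot])
      refine ⟨I', rfl, ih I' (lt_of_le_of_ne Ideal.mul_le_right ?_) hI'0 ?_⟩
      · intro h
        apply hT1
        have : T * I' = 1 * I' := by rw [h, one_mul]
        rw [mul_right_cancel₀ hI'0 this, Ideal.one_eq_top]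
      · rw [Ideal.map_mul, hTs] at hI
        exact mul_left_cancel₀ hT0 hI
    by_cases hram : ∃ i, Associated q (π i)
    · obtain ⟨i, hi⟩ := hram
      have hspan : Ideal.span {algebraMap A R q} = P i ^ 3 := by
        rw [hP, Ideal.span_singleton_eq_span_singleton]
        exact hi.map (algebraMap A R)
      have hPi0 : P i ≠ ⊥ := by
        intro h
        rw [h, Ideal.bot_pow (by norm_num), Ideal.span_singleton_eq_bot] at hspan
        exact hq0 (FaithfulSMul.algebraMap_injective A R (by simpa using hspan))
      obtain ⟨I', rfl, a, n, rfl⟩ := step (P i) hPi0 (hPprime i).ne_top (hPs i) (fun x hx ↦ by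
        have := hcube x hx
        rw [hspan] at this
        exact (hPprime i).mem_of_pow_mem 3 (Ideal.pow_le_self (by norm_num) this))
      classical
      refine ⟨a, n + Pi.single i 1, ?_⟩
      have : ∏ j, P j ^ (n + Pi.single i 1 : ι → ℕ) j = (∏ j, P j ^ n j) * P i := by
        simp only [Pi.add_apply, pow_add, Finset.prod_mul_distrib]
        congr 1
        rw [Finset.prod_eq_single i]
        · simp
        · intro j _ hj; simp [hj]
        · simp
      rw [this]; ring
    · push Not at hram
      have hinj := FaithfulSMul.algebraMap_injective A R
      obtain ⟨I', rfl, a, n, rfl⟩ := step (Ideal.span {algebraMap A R q})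
        (by
          rw [Ne, Ideal.span_singleton_eq_bot]
          exact fun h ↦ hq0 (hinj (by simpa using h)))
        (by
          intro h
          have : Ideal.span {algebraMap A R q} ≤ Q := by
            rw [Ideal.span_singleton_le_iff_mem]
            have : q ∈ Q.under A := by rw [hq]; exact Ideal.mem_span_singleton_self q
            exact this
          exact hQ.ne_top (top_le_iff.mp (h ▸ this)))
        (by rw [Ideal.map_span, Set.image_singleton, AlgHom.commutes])
        (fun x hx ↦ hunr q hqp hram x 3 (hcube x hx))
      refine ⟨q * a, n, ?_⟩
      rw [← mul_assoc, Ideal.span_singleton_mul_span_singleton, map_mul]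

/-- Norms of ideals for an automorphism of order three with cubic ramification. -/
lemma exists_mul_map_mul_map_eq_span [IsDomain A] [IsPrincipalIdealRing A]
    [IsDedekindDomain R] [FaithfulSMul A R] [Algebra.IsIntegral A R] (s : R ≃ₐ[A] R)
    (hs : ∀ x, s (s (s x)) = x)
    (hfix : ∀ x, s x = x → ∃ a, algebraMap A R a = x) {ι : Type*} [Fintype ι] (π : ι → A)
    (P : ι → Ideal R) (hPprime : ∀ i, (P i).IsPrime) (hP : ∀ i, P i ^ 3 = Ideal.span {algebraMap A R (π i)})
    (hPs : ∀ i, (P i).map s = P i)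
    (hunr : ∀ q : A, Prime q → (∀ i, ¬ Associated q (π i)) → ∀ x : R, ∀ n : ℕ,
      x ^ n ∈ Ideal.span {algebraMap A R q} → x ∈ Ideal.span {algebraMap A R q})
    (I : Ideal R) :
    ∃ a : A, I * I.map s * (I.map s).map s = Ideal.span {algebraMap A R a} := by
  have hmm : ∀ J : Ideal R, ((J.map s).map s).map s = J := by
    intro J
    change (((J.map (s : R →+* R)).map (s : R →+* R)).map (s : R →+* R)) = J
    rw [Ideal.map_map, Ideal.map_map]
    have : (((s : R →+* R).comp (s : R →+* R)).comp (s : R →+* R)) = RingHom.id R := by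
      ext x; exact hs x
    rw [this, Ideal.map_id]
  induction I using UniqueFactorizationMonoid.induction_on_prime with
  | h₁ => exact ⟨0, by simp⟩
  | h₂ I hI =>
    rw [Ideal.isUnit_iff] at hI
    exact ⟨1, by simp [hI, Ideal.map_top]⟩
  | h₃ I Q _ hQ ih =>
    obtain ⟨a, ha⟩ := ih
    suffices ∃ b : A, Q * Q.map s * (Q.map s).map s = Ideal.span {algebraMap A R b} by
      obtain ⟨b, hb⟩ := this
      refine ⟨b * a, ?_⟩
      rw [map_mul, ← Ideal.span_singleton_mul_span_singleton, ← ha, ← hb]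
      simp only [Ideal.map_mul]
      ring
    have hQ0 := hQ.ne_zero
    by_cases hex : ∃ i, P i = Q
    · obtain ⟨i, rfl⟩ := hex
      exact ⟨π i, by rw [hPs, hPs, ← hP]; ring⟩
    push Not at hex
    have hne0 : ∀ J : Ideal R, J ≠ ⊥ → J.map s ≠ ⊥ := fun J hJ h ↦
      hJ ((Ideal.map_eq_bot_iff_of_injective s.injective).mp h)
    obtain ⟨a, n, h⟩ := exists_eq_span_mul_prod_of_invariant (s : R →ₐ[A] R) hs hfix π P hPprime
      hP hPs hunr (Q * Q.map s * (Q.map s).map s)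
      (mul_ne_zero (mul_ne_zero hQ0 (hne0 _ hQ0)) (hne0 _ (hne0 _ hQ0)))
      (by
        change Ideal.map s _ = _
        simp only [Ideal.map_mul, hmm]; ring)
    refine ⟨a, ?_⟩
    rw [h, Finset.prod_eq_one, mul_one]
    intro i _
    by_contra hn
    have hni : n i ≠ 0 := fun h ↦ hn (by rw [h, pow_zero])
    have hPi0 : P i ≠ ⊥ := by
      intro h0
      have : (0 : Ideal R) = ∏ i, P i ^ n i := by
        rw [Finset.prod_eq_zero (Finset.mem_univ i)]
        rw [h0]; exact zero_pow hni
      rw [← this, mul_zero] at h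
      exact (mul_ne_zero (mul_ne_zero hQ0 (hne0 _ hQ0)) (hne0 _ (hne0 _ hQ0))) h
    have hPi := Ideal.prime_of_isPrime hPi0 (hPprime i)
    have hdvd : P i ∣ Q * Q.map s * (Q.map s).map s := by
      rw [h]
      exact ((dvd_pow_self _ hni).trans (Finset.dvd_prod_of_mem (fun i ↦ P i ^ n i) (Finset.mem_univ i))).mul_left _
    have hle : ∀ J : Ideal R, J.map s ≤ P i → J ≤ P i := fun J hJ ↦ by
      have h2 := Ideal.map_mono (f := s) (Ideal.map_mono (f := s) hJ)
      rwa [hmm, hPs, hPs] at h2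
    have hQle : Q ≤ P i := by
      rcases hPi.dvd_or_dvd hdvd with h1 | h1
      · rcases hPi.dvd_or_dvd h1 with h1 | h1
        · exact Ideal.dvd_iff_le.mp h1
        · exact hle _ (Ideal.dvd_iff_le.mp h1)
      · exact hle _ (hle _ (Ideal.dvd_iff_le.mp h1))
    have hQmax := (Ideal.isPrime_of_prime hQ).isMaximal hQ0
    exact hex i (hQmax.eq_of_le (hPprime i).ne_top hQle).symm

end InvariantIdeals

section IdealAction

open FractionalIdeal

variable {k K : Type*} [Field k] [Field K] [NumberField K] [Algebra k K]

/-- The action of an automorphism of a number field on fractional ideals. -/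
lemma exists_fractionalIdeal_action (σ : K ≃ₐ[k] K) :
    ∃ Φ : FractionalIdeal (𝓞 K)⁰ K →+* FractionalIdeal (𝓞 K)⁰ K,
      (∀ x, Φ (spanSingleton (𝓞 K)⁰ x) = spanSingleton (𝓞 K)⁰ (σ x)) ∧
      ∀ I : Ideal (𝓞 K), Φ I = (I.map (RingOfIntegers.mapAlgEquiv σ) : Ideal (𝓞 K)) := by
  set s : 𝓞 K →+* 𝓞 K := RingOfIntegers.mapRingHom σ with hsdef
  have hinj : Function.Injective s := (RingOfIntegers.mapAlgEquiv σ).injective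
  have hs : (𝓞 K)⁰ ≤ Submonoid.comap s (𝓞 K)⁰ :=
    nonZeroDivisors_le_comap_nonZeroDivisors_of_injective _ hinj
  refine ⟨extendedHom' K hs, fun x ↦ ?_, fun I ↦ ?_⟩
  · rw [extendedHom'_apply, extended_spanSingleton]
    congr 1
    have : IsLocalization.map K s hs = (σ : K →+* K) := by
      apply IsLocalization.ringHom_ext (𝓞 K)⁰
      ext y
      simp [hsdef]
    rw [this]; rfl
  · rw [extendedHom'_apply, extended_coeIdeal_eq_map]
    rfl

/-- Every element of `K` whose norm generates the unit ideal is a quotient `I / σ(I)`. -/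
lemma exists_unit_fractionalIdeal_mul_eq {σ : K ≃ₐ[k] K}
    {Φ : FractionalIdeal (𝓞 K)⁰ K →+* FractionalIdeal (𝓞 K)⁰ K}
    (hΦ : ∀ x, Φ (spanSingleton (𝓞 K)⁰ x) = spanSingleton (𝓞 K)⁰ (σ x)) {x : K}
    (hx : spanSingleton (𝓞 K)⁰ (x * σ x * σ (σ x)) = 1) :
    ∃ I : FractionalIdeal (𝓞 K)⁰ K, I ≠ 0 ∧ Φ I = spanSingleton (𝓞 K)⁰ x * I := by
  set b : FractionalIdeal (𝓞 K)⁰ K := 1 + spanSingleton (𝓞 K)⁰ x +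
    spanSingleton (𝓞 K)⁰ (x * σ x) with hb
  have hb0 : b ≠ 0 := by
    intro h
    have h1 : (1 : FractionalIdeal (𝓞 K)⁰ K) ≤ b := by
      rw [hb, ← sup_eq_add, ← sup_eq_add]; exact le_sup_left.trans le_sup_left
    rw [h] at h1
    exact one_ne_zero (le_bot_iff.mp h1)
  have key : spanSingleton (𝓞 K)⁰ x * Φ b = b := by
    rw [hb, map_add, map_add, map_one, hΦ, hΦ, mul_add, mul_add, mul_one,
      spanSingleton_mul_spanSingleton, spanSingleton_mul_spanSingleton, map_mul, ← mul_assoc, hx]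
    ring
  have hΦb : Φ b ≠ 0 := fun h ↦ hb0 (by rw [← key, h, mul_zero])
  refine ⟨b⁻¹, inv_ne_zero hb0, ?_⟩
  rw [map_inv₀]
  nth_rewrite 2 [← key]
  have hx0 : spanSingleton (𝓞 K)⁰ x ≠ 0 := fun h ↦ hb0 (by rw [← key, h, zero_mul])
  field_simp

end IdealAction

section IndexOfInvariantIdeals

open FractionalIdeal IsDedekindDomain

variable {k K : Type*} [Field k] [NumberField k] [Field K] [NumberField K] [Algebra k K]

/-- Cubes in `K` of elements of `k` which are products of nonassociated primes up to units have
exponents divisible by three. -/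
lemma three_dvd_of_spanSingleton_eq {ι : Type*} [Fintype ι] {π : ι → 𝓞 k}
    (hπ : ∀ i, Prime (π i)) (hne : ∀ i j, Associated (π i) (π j) → i = j) {e : ι → ℤ} {a : k}
    (h : spanSingleton (𝓞 K)⁰ (algebraMap k K (∏ i, (π i : k) ^ e i)) =
      spanSingleton (𝓞 K)⁰ (algebraMap k K (a ^ 3))) (i : ι) : 3 ∣ e i := by
  have hπ0 : ∀ i, (π i : k) ≠ 0 := fun i ↦ by simpa using (hπ i).ne_zero
  set b : k := ∏ i, (π i : k) ^ e i with hb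
  have hb0 : b ≠ 0 := Finset.prod_ne_zero_iff.mpr fun i _ ↦ zpow_ne_zero _ (hπ0 i)
  have h_int : ∀ x y : k, spanSingleton (𝓞 K)⁰ (algebraMap k K x) =
      spanSingleton (𝓞 K)⁰ (algebraMap k K y) → ∃ u : 𝓞 k, x = u * y := by
    intro x y hxy
    have hx : algebraMap k K x ∈ spanSingleton (𝓞 K)⁰ (algebraMap k K y) := by
      rw [← hxy]; exact mem_spanSingleton_self _ _
    rw [mem_spanSingleton] at hx
    obtain ⟨u, hu⟩ := hx
    rw [Algebra.smul_def] at hu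
    by_cases hy : y = 0
    · exact ⟨0, by
        rw [hy, map_zero, mul_zero] at hu
        have := (algebraMap k K).injective (hu.symm.trans (map_zero _).symm)
        simp [this]⟩
    have hu' : algebraMap (𝓞 K) K u = algebraMap k K (x / y) := by
      rw [map_div₀, ← hu, mul_div_cancel_right₀]
      simpa using hy
    have hxi : IsIntegral ℤ (x / y) := by
      rw [← isIntegral_algebraMap_iff (algebraMap k K).injective, ← hu']
      exact RingOfIntegers.isIntegral_coe u
    exact ⟨⟨x / y, hxi⟩, by
      change x = x / y * y
      field_simp⟩
  obtain ⟨u, hu⟩ := h_int _ _ h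
  obtain ⟨w, hw⟩ := h_int _ _ h.symm
  have ha0 : a ≠ 0 := by
    rintro rfl
    apply hb0
    rw [hu]; simp
  let v : HeightOneSpectrum (𝓞 k) := ⟨Ideal.span {π i},
    (Ideal.span_singleton_prime (hπ i).ne_zero).mpr (hπ i), by
      simpa using (hπ i).ne_zero⟩
  have hle : ∀ x y : k, ∀ u : 𝓞 k, x = u * y → v.valuation k x ≤ v.valuation k y := by
    rintro x y u rfl
    rw [map_mul]
    exact mul_le_of_le_one_left' (v.valuation_le_one u)
  have hval : v.valuation k b = v.valuation k a ^ 3 := by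
    rw [← map_pow]
    exact le_antisymm (hle _ _ _ hu) (hle _ _ _ hw)
  have hb1 : v.valuation k b = WithZero.exp (-1 : ℤ) ^ (e i) := by
    rw [hb, map_prod, Finset.prod_eq_single i]
    · rw [map_zpow₀]
      congr 1
      exact (HeightOneSpectrum.valuation_of_algebraMap v (π i)).trans
        (v.intValuation_singleton (hπ i).ne_zero rfl)
    · intro j _ hj
      rw [map_zpow₀]
      have : v.valuation k (π j) = 1 := by
        refine (HeightOneSpectrum.valuation_of_algebraMap v (π j)).trans ?_
        rw [HeightOneSpectrum.intValuation_eq_one_iff, Ideal.mem_span_singleton]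
        exact fun hd ↦ hj (hne _ _ ((hπ i).associated_of_dvd (hπ j) hd)).symm
      rw [this, one_zpow]
    · simp
  obtain ⟨m, hm⟩ : ∃ m : ℤ, v.valuation k a = WithZero.exp m :=
    ⟨WithZero.log (v.valuation k a), (WithZero.exp_log (by simpa using ha0)).symm⟩
  rw [hb1, hm, ← WithZero.exp_zsmul, ← WithZero.exp_nsmul, WithZero.exp_inj] at hval
  refine ⟨-m, ?_⟩
  simp at hval
  omega

end IndexOfInvariantIdeals

open FractionalIdeal

/-- An automorphism `σ` of order three of a number field `K` of unit rank two with fixed field `k`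
of class number one and unit group `⟨-ω⟩`, ramified exactly at the three primes `π i`, whose prime
divisors in `K` are the `P i`, and such that `ω` is a norm. -/
structure IsCubicExtensionRamifiedAtThreePrimes {k K : Type*} [Field k] [NumberField k] [Field K]
    [NumberField K] [Algebra k K] (σ : K ≃ₐ[k] K) (ω : k) (π : Fin 3 → 𝓞 k)
    (P : Fin 3 → Ideal (𝓞 K)) : Prop where
  apply_three : ∀ x, σ (σ (σ x)) = x
  fixed : ∀ x, σ x = x → ∃ a, algebraMap k K a = x
  hilbert90 : ∀ x, x * σ x * σ (σ x) = 1 → ∃ y, y ≠ 0 ∧ σ y = x * y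
  primitive : IsPrimitiveRoot ω 3
  norm : ∃ y, y * σ y * σ (σ y) = algebraMap k K ω
  units : ∀ u : (𝓞 k)ˣ, ∃ n : ℕ, ((u : 𝓞 k) : k) = (-ω) ^ n
  pid : IsPrincipalIdealRing (𝓞 k)
  rank : Units.rank K = 2
  prime : ∀ i, Prime (π i)
  nonassociated : ∀ i j, Associated (π i) (π j) → i = j
  isPrime : ∀ i, (P i).IsPrime
  pow_three : ∀ i, P i ^ 3 = Ideal.span {algebraMap (𝓞 k) (𝓞 K) (π i)}
  invariant : ∀ i, (P i).map (RingOfIntegers.mapAlgEquiv σ) = P i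
  unramified : ∀ q : 𝓞 k, Prime q → (∀ i, ¬ Associated q (π i)) → ∀ x : 𝓞 K, ∀ n : ℕ,
    x ^ n ∈ Ideal.span {algebraMap (𝓞 k) (𝓞 K) q} → x ∈ Ideal.span {algebraMap (𝓞 k) (𝓞 K) q}

namespace IsCubicExtensionRamifiedAtThreePrimes

variable {k K : Type*} [Field k] [NumberField k] [Field K] [NumberField K] [Algebra k K]
  {σ : K ≃ₐ[k] K} {ω : k} {π : Fin 3 → 𝓞 k} {P : Fin 3 → Ideal (𝓞 K)}

lemma integer_apply_three (h : IsCubicExtensionRamifiedAtThreePrimes σ ω π P) (x : 𝓞 K) :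
    RingOfIntegers.mapAlgEquiv σ (RingOfIntegers.mapAlgEquiv σ (RingOfIntegers.mapAlgEquiv σ x)) =
      x :=
  RingOfIntegers.ext (h.apply_three x)

lemma integer_fixed (h : IsCubicExtensionRamifiedAtThreePrimes σ ω π P) (x : 𝓞 K)
    (hx : RingOfIntegers.mapAlgEquiv σ x = x) : ∃ a, algebraMap (𝓞 k) (𝓞 K) a = x := by
  obtain ⟨a, ha⟩ := h.fixed x (congrArg (algebraMap (𝓞 K) K) hx)
  have hai : IsIntegral ℤ a := by
    rw [← isIntegral_algebraMap_iff (algebraMap k K).injective, ha]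
    exact RingOfIntegers.isIntegral_coe x
  exact ⟨⟨a, hai⟩, RingOfIntegers.ext ha⟩

/-- The product of the conjugates of an ideal is principal. -/
lemma exists_span_eq (h : IsCubicExtensionRamifiedAtThreePrimes σ ω π P) (I : Ideal (𝓞 K)) :
    ∃ a : 𝓞 K, I * I.map (RingOfIntegers.mapAlgEquiv σ) *
      (I.map (RingOfIntegers.mapAlgEquiv σ)).map (RingOfIntegers.mapAlgEquiv σ) =
        Ideal.span {a} := by
  have := h.pid
  obtain ⟨a, ha⟩ := exists_mul_map_mul_map_eq_span (RingOfIntegers.mapAlgEquiv σ)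
    h.integer_apply_three h.integer_fixed π P h.isPrime h.pow_three h.invariant h.unramified I
  exact ⟨_, ha⟩

/-- The prime ideals `P i`, as invertible fractional ideals. -/
lemma exists_units (h : IsCubicExtensionRamifiedAtThreePrimes σ ω π P) :
    ∃ p : Fin 3 → (FractionalIdeal (𝓞 K)⁰ K)ˣ,
      ∀ i, (p i : FractionalIdeal (𝓞 K)⁰ K) = (P i : FractionalIdeal (𝓞 K)⁰ K) := by
  refine ⟨fun i ↦ Units.mk0 (P i : FractionalIdeal (𝓞 K)⁰ K) ?_, fun i ↦ rfl⟩
  rw [Ne, coeIdeal_eq_zero]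
  intro h0
  have := h.pow_three i
  rw [h0, Ideal.bot_pow (by norm_num), eq_comm, Ideal.span_singleton_eq_bot] at this
  exact (h.prime i).ne_zero (FaithfulSMul.algebraMap_injective (𝓞 k) (𝓞 K) (by simpa using this))

/-- The principal ideals generated by elements of `k` have index `27` in the group of invariant
fractional ideals. -/
lemma relIndex_invariant (h : IsCubicExtensionRamifiedAtThreePrimes σ ω π P)
    {Φ : FractionalIdeal (𝓞 K)⁰ K →+* FractionalIdeal (𝓞 K)⁰ K}
    (hΦ : ∀ x, Φ (spanSingleton (𝓞 K)⁰ x) = spanSingleton (𝓞 K)⁰ (σ x))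
    (hΦ' : ∀ I : Ideal (𝓞 K), Φ I = (I.map (RingOfIntegers.mapAlgEquiv σ) : Ideal (𝓞 K)))
    {F : Subgroup (FractionalIdeal (𝓞 K)⁰ K)ˣ} {E : Subgroup Kˣ}
    (hF : ∀ I : (FractionalIdeal (𝓞 K)⁰ K)ˣ, I ∈ F ↔ Φ (I : FractionalIdeal (𝓞 K)⁰ K) = I)
    (hE : ∀ x : Kˣ, x ∈ E ↔ σ x = x) :
    (E.map (toPrincipalIdeal (𝓞 K) K)).relIndex F = 27 := by
  have := h.pid
  obtain ⟨p, hp⟩ := h.exists_units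
  set M := Multiplicative (Fin 3 → ℤ)
  let f : M →* (FractionalIdeal (𝓞 K)⁰ K)ˣ :=
    { toFun := fun e ↦ ∏ i, p i ^ (e.toAdd i)
      map_one' := by simp
      map_mul' := fun e e' ↦ by
        rw [← Finset.prod_mul_distrib]
        exact Finset.prod_congr rfl fun i _ ↦ zpow_add _ _ _ }
  have hf : ∀ e, f e = ∏ i, p i ^ (e.toAdd i) := fun _ ↦ rfl
  set P0 := E.map (toPrincipalIdeal (𝓞 K) K) with hP0
  have hp3 : ∀ i, (p i : FractionalIdeal (𝓞 K)⁰ K) ^ 3 =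
      spanSingleton (𝓞 K)⁰ (algebraMap k K (π i)) := fun i ↦ by
    rw [hp, ← coeIdeal_pow, h.pow_three, coeIdeal_span_singleton]
    rfl
  have hπ0 : ∀ i, (π i : k) ≠ 0 := fun i ↦ by simpa using (h.prime i).ne_zero
  have hmemE : ∀ a : kˣ, Units.map (algebraMap k K).toMonoidHom a ∈ E := fun a ↦ by
    rw [hE]; exact σ.commutes _
  have hFe : F = P0 ⊔ f.range := by
    apply le_antisymm
    · intro I hI
      rw [hF] at hI
      obtain ⟨r, J, hr, hIJ⟩ := exists_eq_spanSingleton_mul (I : FractionalIdeal (𝓞 K)⁰ K)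
      have hsr : ∀ x : 𝓞 K, x ≠ 0 → RingOfIntegers.mapAlgEquiv σ x ≠ 0 := fun x hx ↦ by
        simpa using hx
      set s := RingOfIntegers.mapAlgEquiv σ with hs
      obtain ⟨a, ha⟩ := h.integer_fixed (r * s r * s (s r)) (by
        rw [map_mul, map_mul, h.integer_apply_three]; ring)
      have ha0 : algebraMap (𝓞 k) (𝓞 K) a ≠ 0 := by
        rw [ha]; exact mul_ne_zero (mul_ne_zero hr (hsr _ hr)) (hsr _ (hsr _ hr))
      have hak0 : (a : k) ≠ 0 := by
        intro h0
        apply ha0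
        have : a = 0 := by exact_mod_cast h0
        rw [this, map_zero]
      set T : Ideal (𝓞 K) := Ideal.span {s r * s (s r)} * J with hT
      have hr' : algebraMap (𝓞 K) K r ≠ 0 := by simpa using hr
      have hIT : spanSingleton (𝓞 K)⁰ (algebraMap k K a) * (I : FractionalIdeal (𝓞 K)⁰ K) = T := by
        have : algebraMap k K (a : k) = algebraMap (𝓞 K) K (r * s r * s (s r)) := by
          rw [← ha]; rfl
        rw [hIJ, hT, coeIdeal_mul, coeIdeal_span_singleton, ← mul_assoc,
          spanSingleton_mul_spanSingleton, this]
        congr 2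
        rw [map_mul, map_mul, map_mul]
        field_simp
      have hT0 : T ≠ ⊥ := by
        intro h0
        rw [h0, coeIdeal_bot] at hIT
        rcases mul_eq_zero.mp hIT with h1 | h1
        · rw [spanSingleton_eq_zero_iff] at h1
          exact hak0 (by simpa using h1)
        · exact I.ne_zero h1
      have hTs : T.map s = T := by
        apply coeIdeal_injective (K := K)
        change ((T.map s : Ideal (𝓞 K)) : FractionalIdeal (𝓞 K)⁰ K) = T
        rw [← hΦ', ← hIT, map_mul, hΦ, hI, σ.commutes]
      obtain ⟨b, n, hbn⟩ := exists_eq_span_mul_prod_of_invariant (s : 𝓞 K →ₐ[𝓞 k] 𝓞 K)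
        h.integer_apply_three h.integer_fixed π P h.isPrime h.pow_three h.invariant h.unramified
        T hT0 hTs
      have hb0 : (b : k) ≠ 0 := by
        intro h0
        apply hT0
        have : b = 0 := by exact_mod_cast h0
        rw [hbn, this]; simp
      rw [Subgroup.mem_sup]
      refine ⟨toPrincipalIdeal (𝓞 K) K (Units.map (algebraMap k K).toMonoidHom
        (Units.mk0 ((b : k) / a) (div_ne_zero hb0 hak0))), Subgroup.mem_map_of_mem _ (hmemE _),
        f (Multiplicative.ofAdd fun i ↦ (n i : ℤ)), ⟨_, rfl⟩, ?_⟩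
      rw [Units.ext_iff, Units.val_mul, coe_toPrincipalIdeal, hf]
      have hb' : (T : FractionalIdeal (𝓞 K)⁰ K) = spanSingleton (𝓞 K)⁰ (algebraMap k K b) *
          ∏ i, (p i : FractionalIdeal (𝓞 K)⁰ K) ^ n i := by
        rw [hbn, coeIdeal_mul, coeIdeal_span_singleton]
        simp only [Fin.prod_univ_three, coeIdeal_mul, coeIdeal_pow, hp]
        rfl
      have hsa : spanSingleton (𝓞 K)⁰ (algebraMap k K (a : k)) ≠ 0 := by
        rw [Ne, spanSingleton_eq_zero_iff]; simpa using hak0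
      apply mul_left_cancel₀ hsa
      rw [hIT, hb', ← mul_assoc, spanSingleton_mul_spanSingleton]
      congr 1
      · congr 1
        simp only [RingHom.toMonoidHom_eq_coe, Units.coe_map, MonoidHom.coe_coe, Units.val_mk0,
          ← map_mul]
        congr 1
        field_simp
    · rw [sup_le_iff]
      constructor
      · rintro _ ⟨x, hx, rfl⟩
        rw [hF, coe_toPrincipalIdeal, hΦ, (hE x).mp hx]
      · rintro _ ⟨e, rfl⟩
        rw [hf]
        refine Subgroup.prod_mem _ fun i _ ↦ Subgroup.zpow_mem _ ?_ _
        rw [hF, hp, hΦ', h.invariant]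
  rw [hFe, Subgroup.relIndex_sup_left, ← Subgroup.index_comap]
  have hcomap : P0.comap f = (powMonoidHom 3 : M →* M).range := by
    ext e
    constructor
    · rintro ⟨x, hx, hxe⟩
      obtain ⟨a, ha⟩ := h.fixed x ((hE x).mp hx)
      have hdiv : ∀ i, 3 ∣ e.toAdd i := by
        apply three_dvd_of_spanSingleton_eq (K := K) h.prime h.nonassociated (a := a)
        rw [map_pow, ha, ← spanSingleton_pow, ← coe_toPrincipalIdeal, hxe, hf]
        simp only [Units.coe_prod, Units.val_zpow_eq_zpow_val]
        rw [← Finset.prod_pow]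
        have : ∀ i, ((p i : FractionalIdeal (𝓞 K)⁰ K) ^ (e.toAdd i)) ^ 3 =
            spanSingleton (𝓞 K)⁰ (algebraMap k K ((π i : k) ^ (e.toAdd i))) := fun i ↦ by
          have hz : ∀ (y : Kˣ) (m : ℤ), spanSingleton (𝓞 K)⁰ (y : K) ^ m =
              spanSingleton (𝓞 K)⁰ ((y : K) ^ m) := fun y m ↦ by
            rw [← coe_toPrincipalIdeal, ← Units.val_zpow_eq_zpow_val, ← map_zpow,
              coe_toPrincipalIdeal, Units.val_zpow_eq_zpow_val]
          have hπK : algebraMap k K (π i) ≠ 0 := by simpa using hπ0 i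
          rw [← zpow_natCast, ← zpow_mul, mul_comm, zpow_mul, zpow_natCast, hp3, map_zpow₀]
          exact hz (Units.mk0 _ hπK) _
        simp only [this, Fin.prod_univ_three, spanSingleton_mul_spanSingleton, ← map_mul]
      choose m hm using hdiv
      exact ⟨Multiplicative.ofAdd m, by
        apply Multiplicative.toAdd.injective
        ext i
        change (3 • m) i = e.toAdd i
        rw [hm]
        simp⟩
    · rintro ⟨e, rfl⟩
      refine ⟨Units.map (algebraMap k K).toMonoidHom
        (∏ i, (Units.mk0 (π i : k) (hπ0 i)) ^ (e.toAdd i)), hmemE _, ?_⟩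
      rw [map_prod, map_prod, hf]
      refine Finset.prod_congr rfl fun i _ ↦ ?_
      have : p i ^ 3 = toPrincipalIdeal (𝓞 K) K (Units.map (algebraMap k K).toMonoidHom
          (Units.mk0 (π i : k) (hπ0 i))) := by
        rw [Units.ext_iff, coe_toPrincipalIdeal]
        exact hp3 i
      rw [map_zpow, map_zpow, ← this]
      change _ = p i ^ ((3 • e.toAdd) i)
      rw [← zpow_natCast, ← zpow_mul, Pi.smul_apply, nsmul_eq_mul]
  rw [hcomap]
  have := AddSubgroup.index_range_nsmul (Fin 3 → ℤ) 3
  rw [Module.finrank_fin_fun] at this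
  exact this

end IsCubicExtensionRamifiedAtThreePrimes

open FractionalIdeal

lemma Ideal.map_map_map_eq_self {A R : Type*} [CommRing A] [CommRing R] [Algebra A R]
    {s : R ≃ₐ[A] R} (hs : ∀ x, s (s (s x)) = x) (J : Ideal R) :
    ((J.map s).map s).map s = J := by
  apply le_antisymm
  · rw [Ideal.map_le_iff_le_comap, Ideal.map_le_iff_le_comap, Ideal.map_le_iff_le_comap]
    intro x hx
    simpa only [Ideal.mem_comap, hs] using hx
  · intro x hx
    rw [← hs x]
    exact Ideal.mem_map_of_mem _ (Ideal.mem_map_of_mem _ (Ideal.mem_map_of_mem _ hx))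

namespace IsCubicExtensionRamifiedAtThreePrimes

variable {k K : Type*} [Field k] [NumberField k] [Field K] [NumberField K] [Algebra k K]
  {σ : K ≃ₐ[k] K} {ω : k} {π : Fin 3 → 𝓞 k} {P : Fin 3 → Ideal (𝓞 K)}

/-- A nonzero element of `K` generates the unit ideal if and only if it is a unit of `𝓞 K`. -/
lemma mem_ker_toPrincipalIdeal {x : Kˣ} :
    x ∈ (toPrincipalIdeal (𝓞 K) K).ker ↔
      ∃ u : (𝓞 K)ˣ, Units.map (algebraMap (𝓞 K) K).toMonoidHom u = x := by
  rw [MonoidHom.mem_ker, toPrincipalIdeal_eq_iff, Units.val_one]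
  constructor
  · intro h
    have hx : (x : K) ∈ (1 : FractionalIdeal (𝓞 K)⁰ K) := by
      have := mem_spanSingleton_self (𝓞 K)⁰ (x : K)
      rwa [h] at this
    have hy : (x : K)⁻¹ ∈ (1 : FractionalIdeal (𝓞 K)⁰ K) := by
      have h' : spanSingleton (𝓞 K)⁰ ((x : K)⁻¹) = 1 := by
        rw [← spanSingleton_inv, h]; simp
      have := mem_spanSingleton_self (𝓞 K)⁰ ((x : K)⁻¹)
      rwa [h'] at this
    rw [mem_one_iff] at hx hy
    obtain ⟨u, hu⟩ := hx
    obtain ⟨v, hv⟩ := hy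
    have huv : u * v = 1 := by
      apply FaithfulSMul.algebraMap_injective (𝓞 K) K
      rw [map_mul, hu, hv, map_one, mul_inv_cancel₀ x.ne_zero]
    exact ⟨⟨u, v, huv, by rw [mul_comm, huv]⟩, Units.ext hu⟩
  · rintro ⟨u, rfl⟩
    apply le_antisymm
    · rw [spanSingleton_le_iff_mem, mem_one_iff]
      exact ⟨u, rfl⟩
    · rw [FractionalIdeal.one_le, mem_spanSingleton]
      refine ⟨(u⁻¹ : (𝓞 K)ˣ), ?_⟩
      rw [Algebra.smul_def]
      exact (map_mul (algebraMap (𝓞 K) K) _ _).symm.trans (by simp)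

lemma exists_primitive (h : IsCubicExtensionRamifiedAtThreePrimes σ ω π P) :
    ∃ w : (𝓞 K)ˣ, IsPrimitiveRoot w 3 ∧ ((w : 𝓞 K) : K) = algebraMap k K ω := by
  have hζ : IsPrimitiveRoot (algebraMap k K ω) 3 :=
    h.primitive.map_of_injective (algebraMap k K).injective
  exact ⟨hζ.toInteger_isPrimitiveRoot.isUnit (by norm_num) |>.unit,
    IsPrimitiveRoot.coe_units_iff.mp hζ.toInteger_isPrimitiveRoot, rfl⟩

/-- The action of `σ` on fractional ideals has order three. -/
lemma action_apply_three (h : IsCubicExtensionRamifiedAtThreePrimes σ ω π P)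
    {Φ : FractionalIdeal (𝓞 K)⁰ K →+* FractionalIdeal (𝓞 K)⁰ K}
    (hΦ : ∀ x, Φ (spanSingleton (𝓞 K)⁰ x) = spanSingleton (𝓞 K)⁰ (σ x))
    (hΦ' : ∀ I : Ideal (𝓞 K), Φ I = (I.map (RingOfIntegers.mapAlgEquiv σ) : Ideal (𝓞 K)))
    (I : FractionalIdeal (𝓞 K)⁰ K) : Φ (Φ (Φ I)) = I := by
  obtain ⟨r, J, hr, rfl⟩ := exists_eq_spanSingleton_mul I
  rw [map_mul, map_mul, map_mul, hΦ, hΦ, hΦ, h.apply_three, hΦ', hΦ', hΦ']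
  rw [Ideal.map_map_map_eq_self h.integer_apply_three]

/-- Chevalley's formula: the ideal classes of `K` fixed by `σ` number nine. -/
lemma relIndex_comap_range_toPrincipalIdeal (h : IsCubicExtensionRamifiedAtThreePrimes σ ω π P)
    {Φ : FractionalIdeal (𝓞 K)⁰ K →+* FractionalIdeal (𝓞 K)⁰ K}
    (hΦ : ∀ x, Φ (spanSingleton (𝓞 K)⁰ x) = spanSingleton (𝓞 K)⁰ (σ x))
    (hΦ' : ∀ I : Ideal (𝓞 K), Φ I = (I.map (RingOfIntegers.mapAlgEquiv σ) : Ideal (𝓞 K)))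
    {φ : (FractionalIdeal (𝓞 K)⁰ K)ˣ →* (FractionalIdeal (𝓞 K)⁰ K)ˣ}
    (hφ : ∀ I, φ I = Units.map Φ.toMonoidHom I / I) :
    (toPrincipalIdeal (𝓞 K) K).range.relIndex ((toPrincipalIdeal (𝓞 K) K).range.comap φ) = 9 := by
  set s : Kˣ →* Kˣ := Units.map (σ : K →* K) with hs
  set N : Kˣ →* Kˣ := MonoidHom.id _ * s * s.comp s with hN
  set ψ : Kˣ →* Kˣ := s / MonoidHom.id _ with hψ
  set sJ := Units.map Φ.toMonoidHom with hsJ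
  set prin := toPrincipalIdeal (𝓞 K) K with hprin
  have hsv : ∀ x : Kˣ, ((s x : Kˣ) : K) = σ x := fun _ ↦ rfl
  have hNx : ∀ x, N x = x * s x * s (s x) := fun _ ↦ rfl
  have hψx : ∀ x, ψ x = s x / x := fun _ ↦ rfl
  have hψker : ∀ x, x ∈ ψ.ker ↔ σ (x : K) = x := fun x ↦ by
    rw [MonoidHom.mem_ker, hψx, div_eq_one, Units.ext_iff, hsv]
  obtain ⟨w, hw, hwω⟩ := h.exists_primitive
  set j : (𝓞 K)ˣ →* Kˣ := Units.map (algebraMap (𝓞 K) K).toMonoidHom with hj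
  have hjinj : Function.Injective j := Units.map_injective (FaithfulSMul.algebraMap_injective _ _)
  have hkerj : prin.ker = j.range := by
    ext x; exact mem_ker_toPrincipalIdeal
  have hjw : ((j w : Kˣ) : K) = algebraMap k K ω := hwω
  have hjw3 : IsPrimitiveRoot (j w) 3 := hw.map_of_injective hjinj
  have hw6 : orderOf (-(j w)) = 6 := by
    have h2 : orderOf (-1 : Kˣ) = 2 := by
      refine orderOf_eq_prime (by simp) fun h0 ↦ ?_
      have : (-1 : K) = 1 := by simpa using congrArg Units.val h0
      norm_num at this
    have := (Commute.all (-1 : Kˣ) (j w)).orderOf_mul_eq_mul_orderOf_of_coprime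
      (by rw [h2, ← hjw3.eq_orderOf]; decide)
    rwa [h2, ← hjw3.eq_orderOf, neg_one_mul] at this
  have hpw : j w ∈ prin.ker := by rw [hkerj]; exact ⟨w, rfl⟩
  have hnegw : -(j w) ∈ prin.ker := by
    rw [hkerj]; exact ⟨-w, Units.ext (by simp [hj])⟩
  have hσw : σ (j w : K) = j w := by rw [hjw]; exact σ.commutes _
  have hE : prin.ker ⊓ ψ.ker = Subgroup.zpowers (-(j w)) := by
    apply le_antisymm
    · rintro x ⟨hx1, hx2⟩
      obtain ⟨u, rfl⟩ : x ∈ j.range := hkerj ▸ hx1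
      have hσu : ∀ v : (𝓞 K)ˣ, σ (j v : K) = j v → ∃ a : 𝓞 k, algebraMap (𝓞 k) (𝓞 K) a = v :=
        fun v hv ↦ h.integer_fixed v (RingOfIntegers.ext hv)
      have hu := (hψker _).mp hx2
      obtain ⟨a, ha⟩ := hσu u hu
      obtain ⟨b, hb⟩ := hσu u⁻¹ (by
        rw [map_inv, Units.val_inv_eq_inv_val, map_inv₀, hu])
      have hab : a * b = 1 := by
        apply FaithfulSMul.algebraMap_injective (𝓞 k) (𝓞 K)
        rw [map_mul, ha, hb, map_one, Units.mul_inv]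
      obtain ⟨n, hn⟩ := h.units ⟨a, b, hab, by rw [mul_comm, hab]⟩
      refine ⟨n, Units.ext ?_⟩
      have h1 : ((j u : Kˣ) : K) = algebraMap k K (a : k) := by
        change algebraMap (𝓞 K) K u = _
        rw [← ha]; rfl
      simp only [zpow_natCast, Units.val_pow_eq_pow_val, Units.val_neg]
      rw [h1, hjw, ← map_neg, ← map_pow]
      exact congrArg _ hn.symm
    · rw [Subgroup.zpowers_le]
      refine ⟨hnegw, (hψker _).mpr ?_⟩
      rw [Units.val_neg, map_neg, hσw]
  have hT : prin.ker ⊓ N.ker ⊓ ψ.ker = Subgroup.zpowers (j w) := by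
    apply le_antisymm
    · rintro x ⟨⟨hx1, hx2⟩, hx3⟩
      have hx2 : x * s x * s (s x) = 1 := hx2
      have hsx : s x = x := Units.ext ((hψker x).mp hx3)
      rw [hsx, hsx] at hx2
      exact hjw3.zpowers_eq.symm ▸ (mem_rootsOfUnity 3 x).mpr (by rw [← hx2, _root_.pow_three, mul_assoc])
    · rw [Subgroup.zpowers_le]
      have hsw : s (j w) = j w := Units.ext hσw
      refine ⟨⟨hpw, ?_⟩, (hψker _).mpr hσw⟩
      change j w * s (j w) * s (s (j w)) = 1
      rw [hsw, hsw, ← hjw3.pow_eq_one, _root_.pow_three, mul_assoc]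
  refine Subgroup.relIndex_comap_range_eq_nine (s := s) (ψ := ψ) (N := N) (sJ := sJ) (φ := φ)
    (fun x ↦ Units.ext (h.apply_three x)) ?_ hψx hφ hNx (prin := prin) ?_ ?_ ?_ ?_ ?_ ?_ ?_ ?_ ?_
  · exact fun I ↦ Units.ext (h.action_apply_three hΦ hΦ' _)
  · intro x
    apply Units.ext
    have h1 : Φ (prin x : FractionalIdeal (𝓞 K)⁰ K) = prin (s x) := by
      rw [coe_toPrincipalIdeal, coe_toPrincipalIdeal, hΦ]; rfl
    exact h1.symm
  · have hmap : prin.ker.map (powMonoidHom 3) = (powMonoidHom 3 : (𝓞 K)ˣ →* _).range.map j := by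
      rw [hkerj]
      ext x
      constructor
      · rintro ⟨_, ⟨u, rfl⟩, rfl⟩
        exact ⟨_, ⟨u, rfl⟩, map_pow j u 3⟩
      · rintro ⟨_, ⟨u, rfl⟩, rfl⟩
        exact ⟨_, ⟨u, rfl⟩, (map_pow j u 3).symm⟩
    have hbot : j.ker = ⊥ := (MonoidHom.ker_eq_bot_iff j).mpr hjinj
    rw [hmap, hkerj, MonoidHom.range_eq_map j, ← Subgroup.relIndex_eq_map j le_top
      (by rw [hbot, inf_bot_eq]; exact bot_le), Subgroup.relIndex_top_right,
      Units.index_range_powMonoidHom K (by norm_num), h.rank]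
    have : (powMonoidHom 3 : (𝓞 K)ˣ →* _).ker = Subgroup.zpowers w := by
      rw [hw.zpowers_eq]; rfl
    rw [this, Nat.card_zpowers, ← hw.eq_orderOf]
    norm_num
  · intro x hx
    rw [MonoidHom.mem_ker] at hx
    have : x ∈ prin.ker ⊓ N.ker ⊓ ψ.ker := by
      rw [hT, hjw3.zpowers_eq, mem_rootsOfUnity]; exact hx
    exact this.1
  · rw [hE, Nat.card_zpowers, hw6]
  · rw [hT, Nat.card_zpowers, ← hjw3.eq_orderOf]
  · intro x hx
    obtain ⟨y, hy0, hy⟩ := h.hilbert90 x (by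
      have := congrArg (fun u : Kˣ ↦ (u : K)) hx
      exact this)
    refine ⟨Units.mk0 y hy0, ?_⟩
    rw [hψx, div_eq_iff_eq_mul]
    exact Units.ext hy
  · intro x hx hx'
    have : x ∈ Subgroup.zpowers (-(j w)) := by
      rw [← hE]; exact ⟨hx, hx'⟩
    obtain ⟨n, rfl⟩ := this
    obtain ⟨y, hy⟩ := h.norm
    have hy0 : y ≠ 0 := by
      rintro rfl
      rw [zero_mul, zero_mul, ← hjw] at hy
      exact (j w).ne_zero hy.symm
    refine ⟨(-(Units.mk0 y hy0)) ^ n, ?_⟩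
    rw [map_zpow]
    congr 1
    apply Units.ext
    rw [hNx]
    simp only [Units.val_mul, hsv, Units.val_neg, Units.val_mk0, map_neg, hjw, ← hy]
    ring
  · intro x hx
    obtain ⟨I, hI0, hI⟩ := exists_unit_fractionalIdeal_mul_eq hΦ (x := (x : K)) (by
      rw [MonoidHom.mem_ker, toPrincipalIdeal_eq_iff, hNx] at hx
      exact hx)
    refine ⟨Units.mk0 I hI0, ?_⟩
    rw [hφ, div_eq_iff_eq_mul, Units.ext_iff, Units.val_mul, coe_toPrincipalIdeal]
    exact hI
  · refine h.relIndex_invariant hΦ hΦ' (fun I ↦ ?_) hψker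
    rw [MonoidHom.mem_ker, hφ, div_eq_one, Units.ext_iff]
    rfl

end IsCubicExtensionRamifiedAtThreePrimes

open FractionalIdeal

lemma ClassGroup.ker_mk {R K : Type*} [CommRing R] [IsDedekindDomain R] [Field K]
    [Algebra R K] [IsFractionRing R K] :
    (ClassGroup.mk K : (FractionalIdeal R⁰ K)ˣ →* ClassGroup R).ker =
      (toPrincipalIdeal R K).range := by
  ext I
  rw [MonoidHom.mem_ker, ClassGroup.mk_eq_one_iff, mem_principal_ideals_iff]
  constructor
  · rintro ⟨x, hx⟩
    exact ⟨x, coeToSubmodule_injective ((coe_spanSingleton _ _).trans hx.symm)⟩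
  · rintro ⟨x, hx⟩
    exact ⟨x, by rw [← hx, coe_spanSingleton]⟩

namespace IsCubicExtensionRamifiedAtThreePrimes

variable {k K : Type*} [Field k] [NumberField k] [Field K] [NumberField K] [Algebra k K]
  {σ : K ≃ₐ[k] K} {ω : k} {π : Fin 3 → 𝓞 k} {P : Fin 3 → Ideal (𝓞 K)}

/-- The ideal classes fixed by `σ` form a group of order nine and exponent three. -/
lemma exists_subgroup_classGroup (h : IsCubicExtensionRamifiedAtThreePrimes σ ω π P) :
    ∃ D : Subgroup (ClassGroup (𝓞 K)),
      (∀ c, c ∈ D ↔ ∀ I : (Ideal (𝓞 K))⁰, ClassGroup.mk0 I = c → ∀ J : (Ideal (𝓞 K))⁰,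
        (J : Ideal (𝓞 K)) = (I : Ideal (𝓞 K)).map (RingOfIntegers.mapAlgEquiv σ) →
          ClassGroup.mk0 J = c) ∧
      Nat.card D = 9 ∧ ∀ c ∈ D, c ^ 3 = 1 := by
  obtain ⟨Φ, hΦ, hΦ'⟩ := exists_fractionalIdeal_action σ
  let sJ := Units.map Φ.toMonoidHom
  let φ : (FractionalIdeal (𝓞 K)⁰ K)ˣ →* (FractionalIdeal (𝓞 K)⁰ K)ˣ := sJ / MonoidHom.id _
  have hφ : ∀ I, φ I = sJ I / I := fun _ ↦ rfl
  have h9 := h.relIndex_comap_range_toPrincipalIdeal hΦ hΦ' (φ := φ) hφ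
  rw [← ClassGroup.ker_mk] at h9
  set m : (FractionalIdeal (𝓞 K)⁰ K)ˣ →* ClassGroup (𝓞 K) := ClassGroup.mk K with hm
  have hle : m.ker ≤ m.ker.comap φ := by
    rw [hm, ClassGroup.ker_mk]
    rintro _ ⟨x, rfl⟩
    refine ⟨Units.map (σ : K →* K) x / x, ?_⟩
    rw [hφ, map_div]
    congr 1
    apply Units.ext
    rw [coe_toPrincipalIdeal]
    change _ = Φ _
    rw [coe_toPrincipalIdeal, hΦ]; rfl
  have hmap : ∀ I J : (Ideal (𝓞 K))⁰,
      (J : Ideal (𝓞 K)) = (I : Ideal (𝓞 K)).map (RingOfIntegers.mapAlgEquiv σ) →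
        sJ (FractionalIdeal.mk0 K I) = FractionalIdeal.mk0 K J := fun I J hIJ ↦ by
    apply Units.ext
    change Φ (FractionalIdeal.mk0 K I) = _
    rw [FractionalIdeal.coe_mk0, FractionalIdeal.coe_mk0, hΦ', hIJ]
  have hex : ∀ I : (Ideal (𝓞 K))⁰, ∃ J : (Ideal (𝓞 K))⁰,
      (J : Ideal (𝓞 K)) = (I : Ideal (𝓞 K)).map (RingOfIntegers.mapAlgEquiv σ) := fun I ↦ by
    refine ⟨⟨(I : Ideal (𝓞 K)).map (RingOfIntegers.mapAlgEquiv σ), ?_⟩, rfl⟩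
    rw [mem_nonZeroDivisors_iff_ne_zero, Ne, Ideal.zero_eq_bot,
      Ideal.map_eq_bot_iff_of_injective (RingOfIntegers.mapAlgEquiv σ).injective]
    exact nonZeroDivisors.coe_ne_zero I
  have hD : ∀ c, c ∈ (m.ker.comap φ).map m ↔ ∀ I : (Ideal (𝓞 K))⁰, ClassGroup.mk0 I = c →
      ∀ J : (Ideal (𝓞 K))⁰,
        (J : Ideal (𝓞 K)) = (I : Ideal (𝓞 K)).map (RingOfIntegers.mapAlgEquiv σ) →
          ClassGroup.mk0 J = c := by
    intro c
    constructor
    · rintro ⟨I₀, hI₀, rfl⟩ I hI J hJ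
      rw [← ClassGroup.mk_mk0 K] at hI ⊢
      have h1 : FractionalIdeal.mk0 K I ∈ m.ker.comap φ := by
        rw [← mul_div_cancel I₀ (FractionalIdeal.mk0 K I)]
        refine mul_mem hI₀ (hle ?_)
        rw [MonoidHom.mem_ker, map_div]
        exact div_eq_one.mpr hI
      have h2 : m (sJ (FractionalIdeal.mk0 K I) / FractionalIdeal.mk0 K I) = 1 := h1
      rw [map_div, div_eq_one, hmap I J hJ] at h2
      exact h2.trans hI
    · intro hc
      obtain ⟨I, rfl⟩ := ClassGroup.mk0_surjective c
      obtain ⟨J, hJ⟩ := hex I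
      refine ⟨FractionalIdeal.mk0 K I, ?_, ClassGroup.mk_mk0 K I⟩
      change m (sJ (FractionalIdeal.mk0 K I) / FractionalIdeal.mk0 K I) = 1
      rw [map_div, div_eq_one, hmap I J hJ]
      exact (ClassGroup.mk_mk0 K J).trans ((hc I rfl J hJ).trans (ClassGroup.mk_mk0 K I).symm)
  refine ⟨_, hD, ?_, fun c hc ↦ ?_⟩
  · rw [← Subgroup.relIndex_ker]; exact h9
  · rw [hD] at hc
    obtain ⟨I, hI⟩ := ClassGroup.mk0_surjective c
    obtain ⟨J, hJ⟩ := hex I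
    obtain ⟨J', hJ'⟩ := hex J
    have h1 := hc I hI J hJ
    have h2 := hc J h1 J' hJ'
    obtain ⟨a, ha⟩ := h.exists_span_eq I
    have : ClassGroup.mk0 (I * J * J') = 1 := by
      rw [ClassGroup.mk0_eq_one_iff, Submonoid.coe_mul, Submonoid.coe_mul, hJ', hJ, ha]
      exact ⟨a, rfl⟩
    rw [← this, map_mul, map_mul, h1, h2, hI, _root_.pow_three, mul_assoc]

end IsCubicExtensionRamifiedAtThreePrimes

/-- A commutative group of order nine and exponent three has rank two. -/
lemma Group.rank_eq_two_of_card_eq_nine {G : Type*} [CommGroup G] [Group.FG G]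
    (hG : Nat.card G = 9) (h3 : ∀ x : G, x ^ 3 = 1) : Group.rank G = 2 := by
  have hfin : Finite G := Nat.finite_of_card_ne_zero (by rw [hG]; norm_num)
  have hz : ∀ x : G, Nat.card (Subgroup.zpowers x) ≤ 3 := fun x ↦ by
    rw [Nat.card_zpowers]; exact orderOf_le_of_pow_eq_one (by norm_num) (h3 x)
  apply le_antisymm
  · have key : ∃ x y : G, Subgroup.closure {x, y} = ⊤ := by
      have : Nontrivial G := Finite.one_lt_card_iff_nontrivial.mp (by rw [hG]; norm_num)
      obtain ⟨x, hx⟩ := exists_ne (1 : G)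
      obtain ⟨y, hy⟩ : ∃ y, y ∉ Subgroup.zpowers x := by
        by_contra! hc
        have := hz x
        rw [(Subgroup.eq_top_iff' _).mpr hc, Subgroup.card_top, hG] at this
        omega
      refine ⟨x, y, ?_⟩
      set H := Subgroup.closure {x, y} with hH
      have hxH : x ∈ H := Subgroup.subset_closure (by simp)
      have hyH : y ∈ H := Subgroup.subset_closure (by simp)
      have hlt : Subgroup.zpowers x < H := by
        refine lt_of_le_of_ne ((Subgroup.zpowers_le).mpr hxH) fun h0 ↦ hy (h0 ▸ hyH)
      have hx3 : Nat.card (Subgroup.zpowers x) = 3 := by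
        rw [Nat.card_zpowers]; exact orderOf_eq_prime (h3 x) hx
      have hdvd : Nat.card H ∣ 9 := hG ▸ Subgroup.card_subgroup_dvd_card H
      have hgt : Nat.card (Subgroup.zpowers x) < Nat.card H :=
        Set.ncard_lt_ncard hlt (Set.toFinite _)
      have hle := Nat.le_of_dvd (by norm_num) hdvd
      apply Subgroup.eq_top_of_card_eq
      rw [hG]
      rw [hx3] at hgt
      interval_cases hc : Nat.card H <;> simp_all
    obtain ⟨x, y, hxy⟩ := key
    classical
    calc Group.rank G ≤ ({x, y} : Finset G).card := Group.rank_le (by simpa using hxy)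
      _ ≤ 2 := Finset.card_le_two
  · obtain ⟨S, hS, hc⟩ := Group.rank_spec G
    rw [← hS]
    by_contra! hlt
    have : S.card ≤ 1 := by omega
    obtain ⟨x, hx⟩ : ∃ x : G, (S : Set G) ⊆ {x} := by
      obtain ⟨x, hx⟩ := Finset.card_le_one_iff_subset_singleton.mp this
      exact ⟨x, by exact_mod_cast hx⟩
    have h1 : (⊤ : Subgroup G) ≤ Subgroup.zpowers x := by
      rw [← hc, Subgroup.closure_le]
      intro y hy
      rw [hx hy]; exact Subgroup.mem_zpowers x
    have := hz x
    rw [top_le_iff.mp h1, Subgroup.card_top, hG] at this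
    omega

open Ideal in
/-- The ring of integers of the ninth cyclotomic field is a principal ideal domain. -/
theorem IsCyclotomicExtension.Rat.nine_pid (L : Type*) [Field L] [NumberField L]
    [hL : IsCyclotomicExtension {3 ^ (1 + 1)} ℚ L] : IsPrincipalIdealRing (𝓞 L) := by
  have : IsGalois ℚ L := IsCyclotomicExtension.isGalois {3 ^ (1 + 1)} ℚ L
  have h3 : Fact (Nat.Prime 3) := ⟨Nat.prime_three⟩
  have hφ : Nat.totient (3 ^ (1 + 1)) = 6 := by decide
  have hfr : Module.finrank ℚ L = 6 := by
    rw [IsCyclotomicExtension.finrank (n := 3 ^ (1 + 1)) L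
      (Polynomial.cyclotomic.irreducible_rat (by simp)), hφ]
  have hnr : InfinitePlace.nrComplexPlaces L = 3 := by
    rw [IsCyclotomicExtension.Rat.nrComplexPlaces_eq_totient_div_two (n := 3 ^ (1 + 1)) (h := hL),
      hφ]
  have hb : ⌊(4 / Real.pi) ^ InfinitePlace.nrComplexPlaces L *
      ((Module.finrank ℚ L).factorial / (Module.finrank ℚ L : ℝ) ^ (Module.finrank ℚ L) *
        √|NumberField.discr L|)⌋₊ < 5 := by
    rw [Nat.floor_lt (by positivity), IsCyclotomicExtension.Rat.discr_prime_pow 3 (1 + 1) L,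
      hfr, hnr, hφ]
    have h1 : (4 / Real.pi) ^ 3 < (4 / 3.14) ^ 3 := by
      gcongr
      exact Real.pi_gt_d2
    have h2 : √(19683 : ℝ) < 141 := by
      rw [Real.sqrt_lt' (by norm_num)]; norm_num
    have h4 : (Nat.factorial 6 : ℝ) = 720 := by norm_num [Nat.factorial]
    have h5 : |(((-1) ^ (6 / 2) * (3 : ℕ) ^ (3 ^ (1 + 1 - 1) * ((3 - 1) * (1 + 1) - 1)) : ℤ) : ℝ)| =
        19683 := by norm_num
    push_cast [h4] at h5 ⊢
    refine lt_of_le_of_lt (b := (4 / 3.14) ^ 3 * (720 / 6 ^ 6 * 141)) ?_ (by norm_num)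
    gcongr
    rw [h5]
    exact h2.le
  apply RingOfIntegers.isPrincipalIdealRing_of_isPrincipal_of_lt_or_isPrincipal_of_mem_primesOver_of_mem_Icc
  intro p hp hpp
  have hp' : p ∈ Finset.Icc 1 4 := by
    rw [Finset.mem_Icc] at hp ⊢
    exact ⟨hp.1, by omega⟩
  have hp23 : p = 2 ∨ p = 3 := by
    fin_cases hp' <;> simp_all +decide
  rcases hp23 with rfl | rfl
  · have : Fact (Nat.Prime 2) := ⟨hpp⟩
    have hmax : (span {((2 : ℕ) : ℤ)}).IsMaximal := Int.ideal_span_isMaximal_of_prime 2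
    obtain ⟨⟨P, hP1, hP2⟩⟩ := (span {((2 : ℕ) : ℤ)}).nonempty_primesOver (S := 𝓞 L)
    refine ⟨P, ⟨hP1, hP2⟩, Or.inl ?_⟩
    rw [IsCyclotomicExtension.Rat.inertiaDeg_eq_of_not_dvd (m := 3 ^ (1 + 1)) 2 L P (by decide)]
    have : orderOf ((2 : ℕ) : ZMod (3 ^ (1 + 1))) ≠ 0 ∧
        ∀ n ∈ Finset.Icc 1 2, orderOf ((2 : ℕ) : ZMod (3 ^ (1 + 1))) ≠ n := by
      refine ⟨?_, fun n hn h ↦ ?_⟩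
      · rw [← Nat.pos_iff_ne_zero, orderOf_pos_iff, isOfFinOrder_iff_pow_eq_one]
        exact ⟨6, by norm_num, by decide⟩
      · have := pow_orderOf_eq_one ((2 : ℕ) : ZMod (3 ^ (1 + 1)))
        rw [h] at this
        revert this
        fin_cases hn <;> decide
    have h3 : 3 ≤ orderOf ((2 : ℕ) : ZMod (3 ^ (1 + 1))) := by
      by_contra! hlt
      exact this.2 _ (Finset.mem_Icc.mpr ⟨by omega, by omega⟩) rfl
    calc _ < 5 := hb
      _ ≤ 2 ^ 3 := by norm_num
      _ ≤ _ := Nat.pow_le_pow_right (by norm_num) h3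
  · have hζ := IsCyclotomicExtension.zeta_spec (3 ^ (1 + 1)) ℚ L
    exact ⟨span {hζ.toInteger - 1}, ⟨IsCyclotomicExtension.Rat.isPrime_span_zeta_sub_one 3 1 hζ,
      IsCyclotomicExtension.Rat.liesOver_span_zeta_sub_one 3 1 hζ⟩, Or.inr ⟨_, rfl⟩⟩

section Norms

/-- If `ω` is a cube modulo `π`, then `π` is, up to a unit, a norm from a principal ideal domain
containing a cube root of `ω`. -/
lemma exists_eq_unit_mul_norm {A B : Type*} [CommRing A] [CommRing B] [IsDomain A] [IsDomain B]
    [Algebra A B] [FaithfulSMul A B] [IsPrincipalIdealRing B] {s : B ≃ₐ[A] B}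
    (hs : ∀ x, s (s (s x)) = x) (hfix : ∀ x, s x = x → ∃ a, algebraMap A B a = x) {ω c p : A}
    {η : B} (hω1 : 1 + ω + ω ^ 2 = 0) (hη : η ^ 3 = algebraMap A B ω)
    (hsη : s η = algebraMap A B ω * η) (hp0 : p ≠ 0) (hp : IsCoprime p (1 - ω))
    (hc : p ∣ c ^ 3 - ω) :
    ∃ (x : B) (u : Aˣ), algebraMap A B p = algebraMap A B u * (x * s x * s (s x)) := by
  have hω : ω ^ 3 = 1 := by linear_combination (ω - 1) * hω1
  set f := algebraMap A B
  have hf : Function.Injective f := FaithfulSMul.algebraMap_injective A B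
  obtain ⟨x, hx⟩ := IsPrincipalIdealRing.principal (Ideal.span {f p, η - f c})
  have hmem : ∀ y, y ∈ Ideal.span {f p, η - f c} ↔ x ∣ y := fun y ↦ by
    rw [hx]; exact Ideal.mem_span_singleton
  have hxp : x ∣ f p := (hmem _).mp (Ideal.subset_span (by simp))
  have hxη : x ∣ η - f c := (hmem _).mp (Ideal.subset_span (by simp))
  obtain ⟨α, β, hαβ⟩ := Ideal.mem_span_pair.mp ((hmem x).mpr dvd_rfl)
  have hsf : ∀ a, s (f a) = f a := s.commutes
  have hω' : f ω ^ 3 = 1 := by rw [← map_pow, hω, map_one]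
  have hsx : ∀ y z, y ∣ z → s y ∣ s z := fun y z h ↦ map_dvd s h
  have hcop : IsCoprime x (s x) := by
    obtain ⟨a, b, hab⟩ := hp
    obtain ⟨m, hm⟩ := hc
    have h1 : (1 - ω) * c * (ω ^ 2 * c ^ 2 * b) = 1 - p * (a - b * (1 - ω) * ω ^ 2 * m) := by
      linear_combination (b * (1 - ω) * ω ^ 2) * hm + (b * (1 - ω)) * hω + hab
    obtain ⟨y, hy⟩ := hxp
    obtain ⟨z, hz⟩ := hxη
    have h2 : s x * s z = f ω * η - f c := by
      rw [← map_mul, ← hz, map_sub, hsη, hsf]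
    have h3 := congrArg f h1
    simp only [map_mul, map_sub, map_one, map_pow] at h3
    refine ⟨y * (f a - f b * (1 - f ω) * f ω ^ 2 * f m) + z * f ω * (f ω ^ 2 * f c ^ 2 * f b),
      -(s z * (f ω ^ 2 * f c ^ 2 * f b)), ?_⟩
    linear_combination -(f ω ^ 2 * f c ^ 2 * f b) * h2 -
      (f a - f b * (1 - f ω) * f ω ^ 2 * f m) * hy - f ω * (f ω ^ 2 * f c ^ 2 * f b) * hz + h3
  have hcop2 : IsCoprime (s x) (s (s x)) := hcop.map (s : B →+* B)
  have hcop3 : IsCoprime (s (s x)) x := by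
    have := hcop2.map (s : B →+* B)
    change IsCoprime (s (s x)) (s (s (s x))) at this
    rwa [hs] at this
  have hsxp : s x ∣ f p := hsf p ▸ hsx _ _ hxp
  have hssxp : s (s x) ∣ f p := hsf p ▸ hsx _ _ hsxp
  have hdvd : x * s x * s (s x) ∣ f p :=
    (hcop3.symm.mul_left hcop2).mul_dvd (hcop.mul_dvd hxp hsxp) hssxp
  have hdvd' : f p ∣ x * s x * s (s x) := by
    obtain ⟨m, hm⟩ := hc
    have hm' : f c ^ 3 - f ω = f p * f m := by rw [← map_pow, ← map_sub, hm, map_mul]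
    have h1 : s x = s α * f p + s β * (f ω * η - f c) := by
      rw [← hαβ]
      simp only [map_add, map_mul, map_sub, hsf, hsη]
    have h2 : s (s x) = s (s α) * f p + s (s β) * (f ω ^ 2 * η - f c) := by
      rw [h1]
      simp only [map_add, map_mul, map_sub, hsf, hsη]
      ring
    have h3 : (η - f c) * (f ω * η - f c) * (f ω ^ 2 * η - f c) = f p * (- f m) := by
      have h := congrArg f hω1
      simp only [map_add, map_one, map_pow, map_zero] at h
      linear_combination -hm' + f ω ^ 3 * hη + f ω * hω' +
        (f ω * η * f c ^ 2 - f ω * η ^ 2 * f c) * h + (η * f c ^ 2 - f ω * η * f c ^ 2) * h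
    have h4 : ∀ U V W a b c a' b' c' : B, U * V * W = f p * (- f m) →
        f p ∣ (a * f p + a' * U) * (b * f p + b' * V) * (c * f p + c' * W) := by
      intro U V W a b c a' b' c' h
      refine ⟨a * b * c * f p ^ 2 + (a' * U * b * c + a * b' * V * c + a * b * c' * W) * f p +
        (a' * U * b' * V * c + a' * U * b * c' * W + a * b' * V * c' * W) - a' * b' * c' * f m, ?_⟩
      linear_combination a' * b' * c' * h
    rw [h2, h1, ← hαβ]
    exact h4 _ _ _ _ _ _ _ _ _ h3
  obtain ⟨v, hv⟩ := hdvd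
  obtain ⟨v', hv'⟩ := hdvd'
  have hfp0 : f p ≠ 0 := by simpa [f] using hp0
  have hN0 : x * s x * s (s x) ≠ 0 := fun h0 ↦ hfp0 (by rw [hv, h0, zero_mul])
  have hsN : s (x * s x * s (s x)) = x * s x * s (s x) := by
    rw [map_mul, map_mul, hs]; ring
  have hsv : s v = v := by
    apply mul_left_cancel₀ hN0
    nth_rewrite 1 [← hsN]
    rw [← map_mul, ← hv, hsf, hv]
  have hsv' : s v' = v' := by
    apply mul_left_cancel₀ hfp0
    nth_rewrite 1 [← hsf]
    rw [← map_mul, ← hv', hsN, hv']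
  obtain ⟨w, rfl⟩ := hfix v hsv
  obtain ⟨w', rfl⟩ := hfix v' hsv'
  have hww : w * w' = 1 := by
    apply hf
    apply mul_left_cancel₀ hN0
    rw [map_one, map_mul, ← mul_assoc, ← hv, ← hv', mul_one]
  refine ⟨x, ⟨w, w', hww, by rw [mul_comm, hww]⟩, ?_⟩
  rw [hv, mul_comm]

/-- A form of the symmetry of the cubic norm residue symbol: if `d` is a norm from `k(∛ω)`, then
`ω` is a norm from `k(∛d)`. -/
lemma exists_norm_eq_of_norm_eq {k K L : Type*} [Field k] [Field K] [Field L] [Algebra k K]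
    [Algebra k L] (hKL : Module.finrank k K = Module.finrank k L) [FiniteDimensional k L]
    {ω d : k} (hω : ω ^ 3 = 1) {σ : K ≃ₐ[k] K} {τ : L ≃ₐ[k] L} {η x : L}
    (pb : PowerBasis k K) (hmin : minpoly k pb.gen = Polynomial.X ^ 3 - Polynomial.C d)
    (hσ : σ pb.gen = algebraMap k K ω * pb.gen) (hη : η ^ 3 = algebraMap k L ω)
    (hτ : τ η = algebraMap k L ω * η) (hx : x * τ x * τ (τ x) = algebraMap k L d)
    (hττ : ∀ y, τ (τ (τ y)) = y) :
    ∃ y : K, y * σ y * σ (σ y) = algebraMap k K ω := by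
  have : FiniteDimensional k K := pb.finite
  set j : Module.End k L := LinearMap.mulLeft k x ∘ₗ τ.toLinearMap with hj
  have hjv : ∀ v, j v = x * τ v := fun _ ↦ rfl
  set i : Module.End k L := LinearMap.mulLeft k η with hi
  have hj3 : Polynomial.aeval j (minpoly k pb.gen) = 0 := by
    rw [hmin, map_sub, map_pow, Polynomial.aeval_X, Polynomial.aeval_C]
    ext v
    rw [LinearMap.sub_apply, pow_succ, pow_two, Module.End.mul_apply, Module.End.mul_apply, hjv,
      hjv, hjv, map_mul, map_mul, map_mul, hττ, Module.algebraMap_end_apply, Algebra.smul_def, ← hx,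
      LinearMap.zero_apply]
    ring
  set ρ : K →ₐ[k] Module.End k L := pb.lift j hj3 with hρ
  have hρθ : ρ pb.gen = j := pb.lift_gen _ _
  have hij : ∀ f v, i (ρ f v) = ρ (σ (σ f)) (i v) := by
    intro f
    have hf : f ∈ Algebra.adjoin k {pb.gen} := by rw [pb.adjoin_gen_eq_top]; trivial
    induction hf using Algebra.adjoin_induction with
    | mem y hy =>
      obtain rfl : y = pb.gen := hy
      intro v
      have h : σ (σ pb.gen) = algebraMap k K (ω ^ 2) * pb.gen := by
        rw [hσ, map_mul, hσ, AlgEquiv.commutes, map_pow]; ring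
      rw [h, map_mul, AlgHom.commutes, hρθ, Module.End.mul_apply, Module.algebraMap_end_apply,
        hjv, hjv, Algebra.smul_def, map_pow]
      have hω' : algebraMap k L ω ^ 3 = 1 := by rw [← map_pow, hω, map_one]
      simp only [hi, LinearMap.mulLeft_apply, map_mul, hτ]
      linear_combination -(η * x * τ v) * hω'
    | algebraMap r =>
      intro v
      simp only [AlgEquiv.commutes, AlgHom.commutes, Module.algebraMap_end_apply, map_smul]
    | add a b _ _ ha hb =>
      intro v
      simp only [map_add, LinearMap.add_apply, ha, hb]
    | mul a b _ _ ha hb =>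
      intro v
      simp only [map_mul, Module.End.mul_apply, ha, hb]
  set e : K →ₗ[k] L := (LinearMap.applyₗ (1 : L)) ∘ₗ ρ.toLinearMap with he
  have hev : ∀ f, e f = ρ f 1 := fun _ ↦ rfl
  have hinj : Function.Injective e := by
    rw [injective_iff_map_eq_zero]
    intro f hf
    by_contra hf0
    have : ρ (f⁻¹ * f) 1 = 0 := by rw [map_mul, Module.End.mul_apply, ← hev, hf, map_zero]
    rw [inv_mul_cancel₀ hf0, map_one ρ, Module.End.one_apply] at this
    exact one_ne_zero this
  obtain ⟨a, ha⟩ := (LinearMap.injective_iff_surjective_of_finrank_eq_finrank hKL).mp hinj η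
  have hσσ : ∀ f, σ (σ (σ f)) = f := by
    have h : ((σ.trans σ).trans σ : K →ₐ[k] K) = AlgHom.id k K := by
      apply pb.algHom_ext
      have hω' : algebraMap k K ω ^ 3 = 1 := by rw [← map_pow, hω, map_one]
      change σ (σ (σ pb.gen)) = pb.gen
      simp only [hσ, map_mul, AlgEquiv.commutes]
      linear_combination pb.gen * hω'
    exact fun f ↦ DFunLike.congr_fun h f
  refine ⟨a, hinj ?_⟩
  have h1 : i 1 = ρ a 1 := by rw [← hev, ha]; exact mul_one η
  have h2 : i (i (i 1)) = ρ (a * σ a * σ (σ a)) 1 := by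
    rw [h1, hij, h1, hij, hij, h1, hσσ]
    simp only [← Module.End.mul_apply, ← map_mul]
    congr 2
    ring
  rw [hev, ← h2, hev, AlgHom.commutes, Module.algebraMap_end_apply, Algebra.smul_def, ← hη]
  simp [hi]
  ring

end Norms

section CubicKummer

variable {k E : Type} [Field k] [Field E] [Algebra k E] {ω a : k} {θ : E}

lemma minpoly_eq_X_pow_three_sub_C (hθ : θ ^ 3 = algebraMap k E a)
    (H : Irreducible (Polynomial.X ^ 3 - Polynomial.C a)) :
    minpoly k θ = Polynomial.X ^ 3 - Polynomial.C a :=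
  (minpoly.eq_of_irreducible_of_monic H (by simp [hθ])
    (Polynomial.monic_X_pow_sub_C _ three_ne_zero)).symm

lemma finrank_eq_three_of_adjoin_eq_top (hθ : θ ^ 3 = algebraMap k E a)
    (H : Irreducible (Polynomial.X ^ 3 - Polynomial.C a)) (hgen : k⟮θ⟯ = ⊤) :
    Module.finrank k E = 3 := by
  have h_int : IsIntegral k θ := ⟨_, Polynomial.monic_X_pow_sub_C a three_ne_zero, by simp [hθ]⟩
  rw [← IntermediateField.finrank_top', ← hgen, IntermediateField.adjoin.finrank h_int,
    minpoly_eq_X_pow_three_sub_C hθ H, Polynomial.natDegree_X_pow_sub_C]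

lemma exists_powerBasis_gen_eq (hθ : θ ^ 3 = algebraMap k E a) (hgen : k⟮θ⟯ = ⊤) :
    ∃ pb : PowerBasis k E, pb.gen = θ := by
  have h_int : IsIntegral k θ := ⟨_, Polynomial.monic_X_pow_sub_C a three_ne_zero, by simp [hθ]⟩
  have hadj : Algebra.adjoin k {θ} = ⊤ := by
    rw [← IntermediateField.adjoin_simple_toSubalgebra_of_isAlgebraic h_int.isAlgebraic, hgen,
      IntermediateField.top_toSubalgebra]
  exact ⟨PowerBasis.ofAdjoinEqTop h_int hadj, PowerBasis.ofAdjoinEqTop_gen h_int hadj⟩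

lemma isGalois_of_pow_three_eq (hω : IsPrimitiveRoot ω 3) (hθ : θ ^ 3 = algebraMap k E a)
    (H : Irreducible (Polynomial.X ^ 3 - Polynomial.C a)) (hgen : k⟮θ⟯ = ⊤) : IsGalois k E := by
  have h3 := finrank_eq_three_of_adjoin_eq_top hθ H hgen
  have : FiniteDimensional k E := Module.finite_of_finrank_pos (by omega)
  have hne : (primitiveRoots 3 k).Nonempty := ⟨ω, (mem_primitiveRoots three_pos).mpr hω⟩
  have := isSplittingField_X_pow_sub_C_of_root_adjoin_eq_top (K := k) (L := E) (a := a) (α := θ)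
    (by rwa [h3]) (by rwa [h3]) hgen
  rw [h3] at this
  exact isGalois_of_isSplittingField_X_pow_sub_C hne H E

lemma exists_algEquiv_apply_eq_mul (hω : IsPrimitiveRoot ω 3) (hθ : θ ^ 3 = algebraMap k E a)
    (H : Irreducible (Polynomial.X ^ 3 - Polynomial.C a)) (hgen : k⟮θ⟯ = ⊤) :
    ∃ σ : E ≃ₐ[k] E, σ θ = algebraMap k E ω * θ := by
  have := isGalois_of_pow_three_eq hω hθ H hgen
  have h_int : IsIntegral k θ := ⟨_, Polynomial.monic_X_pow_sub_C a three_ne_zero, by simp [hθ]⟩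
  have hω' : algebraMap k E ω ^ 3 = 1 := by rw [← map_pow, hω.pow_eq_one, map_one]
  have hc : IsConjRoot k θ (algebraMap k E ω * θ) := by
    rw [isConjRoot_iff_aeval_eq_zero h_int, minpoly_eq_X_pow_three_sub_C hθ H]
    simp [mul_pow, hω', hθ]
  exact isConjRoot_iff_exists_algEquiv.mp hc.symm

variable {σ : E ≃ₐ[k] E}

lemma algEquiv_apply_three (hω : IsPrimitiveRoot ω 3) (hθ : θ ^ 3 = algebraMap k E a)
    (hgen : k⟮θ⟯ = ⊤) (hσ : σ θ = algebraMap k E ω * θ) (x : E) : σ (σ (σ x)) = x := by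
  obtain ⟨pb, rfl⟩ := exists_powerBasis_gen_eq hθ hgen
  have h : ((σ.trans σ).trans σ : E →ₐ[k] E) = AlgHom.id k E := by
    apply pb.algHom_ext
    have hω' : algebraMap k E ω ^ 3 = 1 := by rw [← map_pow, hω.pow_eq_one, map_one]
    change σ (σ (σ pb.gen)) = pb.gen
    simp only [hσ, map_mul, AlgEquiv.commutes]
    linear_combination pb.gen * hω'
  exact DFunLike.congr_fun h x

lemma mem_zpowers_algEquiv (hω : IsPrimitiveRoot ω 3) (hθ : θ ^ 3 = algebraMap k E a)
    (H : Irreducible (Polynomial.X ^ 3 - Polynomial.C a)) (hgen : k⟮θ⟯ = ⊤)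
    (hσ : σ θ = algebraMap k E ω * θ) (τ : E ≃ₐ[k] E) : τ ∈ Subgroup.zpowers σ := by
  have := isGalois_of_pow_three_eq hω hθ H hgen
  have h3 := finrank_eq_three_of_adjoin_eq_top hθ H hgen
  have : FiniteDimensional k E := Module.finite_of_finrank_pos (by omega)
  have hθ0 : θ ≠ 0 := by
    rintro rfl
    have ha : a = 0 := by simpa using hθ.symm
    rw [ha, map_zero, sub_zero] at H
    exact not_irreducible_pow (by norm_num) H
  have hord : orderOf σ = 3 := by
    have : Fact (Nat.Prime 3) := ⟨Nat.prime_three⟩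
    refine orderOf_eq_prime (AlgEquiv.ext fun x ↦ algEquiv_apply_three hω hθ hgen hσ x) ?_
    rintro rfl
    have h1 : algebraMap k E ω * θ = 1 * θ := by rw [← hσ, one_mul]; rfl
    exact hω.ne_one (by norm_num) ((algebraMap k E).injective (by
      rw [mul_right_cancel₀ hθ0 h1, map_one]))
  have : Subgroup.zpowers σ = ⊤ := by
    apply Subgroup.eq_top_of_card_eq
    rw [Nat.card_zpowers, hord, IsGalois.card_aut_eq_finrank, h3]
  rw [this]; trivial

lemma exists_algebraMap_eq_of_apply_eq (hω : IsPrimitiveRoot ω 3) (hθ : θ ^ 3 = algebraMap k E a)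
    (H : Irreducible (Polynomial.X ^ 3 - Polynomial.C a)) (hgen : k⟮θ⟯ = ⊤)
    (hσ : σ θ = algebraMap k E ω * θ) {x : E} (hx : σ x = x) : ∃ b, algebraMap k E b = x := by
  have := isGalois_of_pow_three_eq hω hθ H hgen
  have h3 := finrank_eq_three_of_adjoin_eq_top hθ H hgen
  have : FiniteDimensional k E := Module.finite_of_finrank_pos (by omega)
  refine (IsGalois.mem_range_algebraMap_iff_fixed x).mpr fun τ ↦ ?_
  have : Subgroup.zpowers σ ≤ MulAction.stabilizer (E ≃ₐ[k] E) x := by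
    rw [Subgroup.zpowers_le]; exact hx
  exact this (mem_zpowers_algEquiv hω hθ H hgen hσ τ)

lemma exists_apply_eq_mul_of_norm_eq_one (hω : IsPrimitiveRoot ω 3)
    (hθ : θ ^ 3 = algebraMap k E a) (H : Irreducible (Polynomial.X ^ 3 - Polynomial.C a))
    (hgen : k⟮θ⟯ = ⊤) (hσ : σ θ = algebraMap k E ω * θ) {x : E} (hx : x * σ x * σ (σ x) = 1) :
    ∃ y, y ≠ 0 ∧ σ y = x * y := by
  set b := x⁻¹ with hb
  have hx0 : x ≠ 0 := by rintro rfl; simp at hx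
  have hbN : b * σ b * σ (σ b) = 1 := by
    rw [hb, map_inv₀, map_inv₀, ← mul_inv, ← mul_inv, hx, inv_one]
  have h3 := algEquiv_apply_three hω hθ hgen hσ
  obtain ⟨z, hz⟩ : ∃ z, z + b * σ z + b * σ b * σ (σ z) ≠ 0 := by
    by_contra! h
    have h1 := h 1
    have h2 := h θ
    have h4 := h (θ ^ 2)
    simp only [map_one, map_pow, map_mul, hσ, AlgEquiv.commutes] at h1 h2 h4
    have hθ0 : θ ≠ 0 := by
      rintro rfl
      have ha : a = 0 := by simpa using hθ.symm
      rw [ha, map_zero, sub_zero] at H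
      exact not_irreducible_pow (by norm_num) H
    set w := algebraMap k E ω
    have hw : 1 + w + w ^ 2 = 0 := by
      have := hω.geom_sum_eq_zero (by norm_num)
      simp only [Finset.sum_range_succ, Finset.sum_range_zero, pow_zero, pow_one, zero_add] at this
      simpa [w] using congrArg (algebraMap k E) this
    have h5 : 3 * θ ^ 2 = 0 := by
      linear_combination θ ^ 2 * h1 + θ * h2 + h4 - θ ^ 2 * b * hw -
        θ ^ 2 * b * σ b * (w ^ 2 - w + 1) * hw
    have h30 : (3 : E) ≠ 0 := by
      intro h0
      have hw1 : (w - 1) ^ 2 = 0 := by linear_combination hw - w * h0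
      have : w = 1 := by simpa [sub_eq_zero] using hw1
      exact hω.ne_one (by norm_num) ((algebraMap k E).injective (by rw [map_one, ← this]))
    exact mul_ne_zero h30 (pow_ne_zero 2 hθ0) h5
  refine ⟨_, hz, ?_⟩
  simp only [map_add, map_mul, h3]
  have hxb : x * b = 1 := mul_inv_cancel₀ hx0
  linear_combination (-σ z - σ b * σ (σ z)) * hxb + x * z * hbN -
    (σ b * σ (σ b) * z) * hxb
end CubicKummer

section CyclotomicNine

variable {k : Type} [Field k] [NumberField k] [IsCyclotomicExtension {3} ℚ k] {ω : 𝓞 k}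

lemma one_add_add_sq_eq_zero {A : Type*} [CommRing A] [IsDomain A] {ω : A}
    (hω : IsPrimitiveRoot ω 3) : 1 + ω + ω ^ 2 = 0 := by
  have := hω.geom_sum_eq_zero (by norm_num)
  simpa only [Finset.sum_range_succ, Finset.sum_range_zero, pow_zero, pow_one, zero_add] using this

lemma exists_unit_eq_neg_pow (hω : IsPrimitiveRoot ω 3) (u : (𝓞 k)ˣ) :
    ∃ n : ℕ, (u : 𝓞 k) = (-ω) ^ n := by
  have hω' : IsPrimitiveRoot (ω : k) 3 := hω.map_of_injective RingOfIntegers.coe_injective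
  have h1 : ω ^ 3 = 1 := hω.pow_eq_one
  have h := IsCyclotomicExtension.Rat.Three.Units.mem hω' u
  have h2 : ((hω'.toInteger_isPrimitiveRoot.isUnit (by decide)).unit : 𝓞 k) = ω := rfl
  simp only [List.mem_cons, List.not_mem_nil, or_false] at h
  rcases h with rfl | rfl | rfl | rfl | rfl | rfl
  · exact ⟨0, by simp⟩
  · exact ⟨3, by push_cast; linear_combination h1⟩
  · exact ⟨4, by rw [h2]; linear_combination -ω * h1⟩
  · exact ⟨1, by push_cast; rw [h2]; ring⟩
  · exact ⟨2, by push_cast; rw [h2]; ring⟩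
  · exact ⟨5, by push_cast; rw [h2]; linear_combination ω ^ 2 * h1⟩

/-- In a finite field with `n ≡ 1 (mod 9)` elements, the cube roots of unity are cubes. -/
lemma exists_pow_three_eq_of_card {F : Type*} [Field F] [Finite F] (hF : Nat.card F % 9 = 1) {w : F}
    (hw : w ^ 3 = 1) : ∃ c, c ^ 3 = w := by
  obtain ⟨g, hg⟩ := IsCyclic.exists_generator (α := Fˣ)
  have hw0 : w ≠ 0 := by rintro rfl; simp at hw
  obtain ⟨n, hn⟩ := Subgroup.mem_zpowers_iff.mp (hg (Units.mk0 w hw0))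
  have h1 : g ^ (n * 3) = 1 := by
    rw [zpow_mul, hn]; ext; simpa using hw
  have h2 : orderOf g = Nat.card F - 1 := by
    rw [orderOf_eq_card_of_forall_mem_zpowers hg, Nat.card_units]
  have h3 := orderOf_dvd_iff_zpow_eq_one.mpr h1
  have h4 : (9 : ℤ) ∣ n * 3 := by
    refine dvd_trans ?_ h3
    rw [h2]
    exact_mod_cast (by omega : 9 ∣ Nat.card F - 1)
  obtain ⟨m, rfl⟩ : (3 : ℤ) ∣ n := by omega
  refine ⟨(g ^ m : Fˣ), ?_⟩
  rw [← Units.val_pow_eq_pow_val, ← zpow_natCast, ← zpow_mul, mul_comm]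
  exact congrArg Units.val hn

lemma finite_quotient_span_of_prime {π : 𝓞 k} (hπ : Prime π) : Finite (𝓞 k ⧸ Ideal.span {π}) :=
  Ideal.finiteQuotientOfFreeOfNeBot _ (by simpa using hπ.ne_zero)

lemma exists_dvd_pow_three_sub (hω : IsPrimitiveRoot ω 3) {π : 𝓞 k} (hπ : Prime π)
    (hcard : Nat.card (𝓞 k ⧸ Ideal.span {π}) % 9 = 1) : ∃ c, π ∣ c ^ 3 - ω := by
  have hprime : (Ideal.span {π}).IsPrime := (Ideal.span_singleton_prime hπ.ne_zero).mpr hπ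
  have hmax : (Ideal.span {π}).IsMaximal := hprime.isMaximal (by simpa using hπ.ne_zero)
  have := finite_quotient_span_of_prime hπ
  let _ : Field (𝓞 k ⧸ Ideal.span {π}) := Ideal.Quotient.field _
  obtain ⟨c, hc⟩ := exists_pow_three_eq_of_card hcard (w := Ideal.Quotient.mk _ ω)
    (by rw [← map_pow, hω.pow_eq_one, map_one])
  obtain ⟨c, rfl⟩ := Ideal.Quotient.mk_surjective c
  refine ⟨c, ?_⟩
  rw [← map_pow, Ideal.Quotient.eq] at hc
  exact Ideal.mem_span_singleton.mp hc

lemma not_dvd_three_of_card {π : 𝓞 k} (hπ : Prime π)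
    (hcard : Nat.card (𝓞 k ⧸ Ideal.span {π}) % 9 = 1) : ¬ π ∣ 3 := by
  intro h
  have := finite_quotient_span_of_prime hπ
  have h0 : ((3 : ℕ) : 𝓞 k ⧸ Ideal.span {π}) = 0 := by
    rw [← map_natCast (Ideal.Quotient.mk _), Ideal.Quotient.eq_zero_iff_mem]
    exact Ideal.mem_span_singleton.mpr (by exact_mod_cast h)
  have hn : ((Nat.card (𝓞 k ⧸ Ideal.span {π}) : ℕ) : 𝓞 k ⧸ Ideal.span {π}) = 0 := by
    let _ := Fintype.ofFinite (𝓞 k ⧸ Ideal.span {π})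
    rw [Nat.card_eq_fintype_card, Nat.cast_card_eq_zero]
  have h1 : Nat.card (𝓞 k ⧸ Ideal.span {π}) =
    3 * (3 * (Nat.card (𝓞 k ⧸ Ideal.span {π}) / 9)) + 1 := by omega
  rw [h1, Nat.cast_add, Nat.cast_mul, h0, zero_mul, zero_add, Nat.cast_one,
    ← map_one (Ideal.Quotient.mk _), Ideal.Quotient.eq_zero_iff_mem,
    Ideal.mem_span_singleton] at hn
  exact hπ.not_isUnit (isUnit_of_dvd_one hn)

lemma isCoprime_one_sub_of_card (hω : IsPrimitiveRoot ω 3) {π : 𝓞 k} (hπ : Prime π)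
    (hcard : Nat.card (𝓞 k ⧸ Ideal.span {π}) % 9 = 1) : IsCoprime π (1 - ω) := by
  have : IsPrincipalIdealRing (𝓞 k) := IsCyclotomicExtension.Rat.three_pid k
  refine (hπ.irreducible.coprime_iff_not_dvd).mpr fun h ↦ not_dvd_three_of_card hπ hcard ?_
  have h1 := one_add_add_sq_eq_zero hω
  exact h.trans ⟨2 + ω, by linear_combination h1⟩

variable {L : Type} [Field L] [NumberField L] [Algebra k L] [IsCyclotomicExtension {9} k L]

lemma isCyclotomicExtension_nine (k L : Type) [Field k] [NumberField k]
    [IsCyclotomicExtension {3} ℚ k] [Field L] [NumberField L] [Algebra k L]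
    [IsCyclotomicExtension {9} k L] : IsCyclotomicExtension {9} ℚ L := by
  have h := IsCyclotomicExtension.trans {3} {9} ℚ k L (algebraMap k L).injective
  rw [Set.union_comm] at h
  exact (IsCyclotomicExtension.iff_union_of_dvd (n := 3) (S := {9}) ℚ L
    ⟨9, rfl, by norm_num, by norm_num⟩).mpr h

variable (k L) in
lemma finrank_cyclotomicExtension_nine : Module.finrank k L = 3 := by
  have := isCyclotomicExtension_nine k L
  have h1 := IsCyclotomicExtension.Rat.finrank 3 k
  have h2 := IsCyclotomicExtension.Rat.finrank 9 L
  have h3 := Module.finrank_mul_finrank ℚ k L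
  have e1 : Nat.totient 3 = 2 := by decide
  have e2 : Nat.totient 9 = 6 := by decide
  rw [h1, h2, e1, e2] at h3
  omega

variable (L) in
lemma exists_pow_three_eq_adjoin_eq_top {w : k} (hω : IsPrimitiveRoot w 3) :
    ∃ η : L, η ^ 3 = algebraMap k L w ∧ k⟮η⟯ = ⊤ := by
  have hζ := IsCyclotomicExtension.zeta_spec 9 k L
  set ζ := IsCyclotomicExtension.zeta 9 k L
  have h3 : IsPrimitiveRoot (ζ ^ 3) 3 := hζ.pow (by norm_num) (by norm_num)
  obtain ⟨i, -, hi, h⟩ := h3.isPrimitiveRoot_iff.mp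
    (hω.map_of_injective (algebraMap k L).injective)
  refine ⟨ζ ^ i, by rw [← h]; ring, ?_⟩
  have h9 : IsPrimitiveRoot (ζ ^ i) 9 :=
    hζ.pow_of_coprime i (by
      rw [show (9 : ℕ) = 3 ^ 2 by norm_num]; exact hi.pow_right 2)
  exact IntermediateField.adjoin_eq_top_of_algebra k _
    (IsCyclotomicExtension.adjoin_primitive_root_eq_top h9)

/-- An element of `𝓞 k` all of whose prime factors divide `3` or have norm congruent to `1`
modulo `9` is a norm from `k(ζ₉)`. -/
lemma exists_norm_eq_mul_prod (hω : IsPrimitiveRoot ω 3) {η : L} {τ : L ≃ₐ[k] L}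
    (hη : η ^ 3 = algebraMap k L ω) (hgen : k⟮η⟯ = ⊤) (hτ : τ η = algebraMap k L ω * η)
    {ι : Type*} (s : Finset ι) (π : ι → 𝓞 k) (hπ : ∀ i ∈ s, Prime (π i))
    (hπ' : ∀ i ∈ s, Associated (π i) (1 - ω) ∨ Nat.card (𝓞 k ⧸ Ideal.span {π i}) % 9 = 1)
    (u : (𝓞 k)ˣ) (e : ι → ℕ) :
    ∃ x, x * τ x * τ (τ x) = algebraMap k L ((u : 𝓞 k) * ∏ i ∈ s, π i ^ e i : 𝓞 k) := by
  have hω' : IsPrimitiveRoot (ω : k) 3 := hω.map_of_injective RingOfIntegers.coe_injective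
  have h9 := isCyclotomicExtension_nine k L
  have h9' : IsCyclotomicExtension {3 ^ (1 + 1)} ℚ L := h9
  have hpid := IsCyclotomicExtension.Rat.nine_pid L
  have h3 := finrank_cyclotomicExtension_nine k L
  have hH : Irreducible (Polynomial.X ^ 3 - Polynomial.C (ω : k)) := by
    have := irreducible_X_pow_sub_C_of_root_adjoin_eq_top (K := k) (L := L) (a := (ω : k)) (α := η)
      (by rw [h3]; exact hη) hgen
    rwa [h3] at this
  have hτ3 := algEquiv_apply_three hω' hη hgen hτ
  have hω3 : algebraMap k L ω ^ 3 = 1 := by rw [← map_pow, hω'.pow_eq_one, map_one]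
  have hω1 : 1 + algebraMap k L ω + algebraMap k L ω ^ 2 = 0 :=
    one_add_add_sq_eq_zero (hω'.map_of_injective (algebraMap k L).injective)
  let M : Submonoid (𝓞 k) :=
    { carrier := {a | ∃ x, x * τ x * τ (τ x) = algebraMap k L a}
      one_mem' := ⟨1, by simp⟩
      mul_mem' := by
        rintro a b ⟨x, hx⟩ ⟨y, hy⟩
        refine ⟨x * y, ?_⟩
        simp only [map_mul, ← hx, ← hy]
        ring }
  have hMu : ∀ v : (𝓞 k)ˣ, (v : 𝓞 k) ∈ M := by
    intro v
    obtain ⟨n, hn⟩ := exists_unit_eq_neg_pow hω v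
    rw [hn]
    suffices h : -ω ∈ M from pow_mem h n
    refine ⟨-η, ?_⟩
    simp only [map_neg, map_mul, hτ, AlgEquiv.commutes]
    linear_combination -hη - η ^ 3 * hω3
  have hM : ∀ i ∈ s, π i ∈ M := by
    intro i hi
    rcases hπ' i hi with h | h
    · obtain ⟨v, hv⟩ := h.symm
      rw [← hv]
      suffices h : 1 - ω ∈ M from mul_mem h (hMu v)
      refine ⟨1 - η, ?_⟩
      simp only [map_sub, map_one, map_mul, hτ, AlgEquiv.commutes]
      linear_combination -hη - η ^ 3 * hω3 - η * hω1 + algebraMap k L ω * η ^ 2 * hω1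
    · obtain ⟨c, hc⟩ := exists_dvd_pow_three_sub hω (hπ i hi) h
      have hη' : IsIntegral ℤ η := by
        refine IsIntegral.of_pow (n := 3) (by norm_num) ?_
        rw [hη]
        exact (RingOfIntegers.isIntegral_coe ω).algebraMap
      obtain ⟨x, v, hx⟩ := exists_eq_unit_mul_norm (A := 𝓞 k) (B := 𝓞 L)
        (s := RingOfIntegers.mapAlgEquiv τ) (ω := ω) (c := c) (p := π i) (η := ⟨η, hη'⟩)
        (fun x ↦ RingOfIntegers.ext (hτ3 x)) (by
          intro x hx
          obtain ⟨b, hb⟩ := exists_algebraMap_eq_of_apply_eq hω' hη hH hgen hτ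
            (x := (x : L)) (congrArg (algebraMap (𝓞 L) L) hx)
          have hbi : IsIntegral ℤ b := by
            rw [← isIntegral_algebraMap_iff (algebraMap k L).injective, hb]
            exact RingOfIntegers.isIntegral_coe x
          exact ⟨⟨b, hbi⟩, RingOfIntegers.ext hb⟩)
        (one_add_add_sq_eq_zero hω) (RingOfIntegers.ext hη) (RingOfIntegers.ext hτ)
        (hπ i hi).ne_zero (isCoprime_one_sub_of_card hω (hπ i hi) h) hc
      have hx' : (x : L) * τ x * τ (τ x) = algebraMap k L (((v⁻¹ : (𝓞 k)ˣ) : 𝓞 k) * π i : 𝓞 k) := by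
        have h1 : x * RingOfIntegers.mapAlgEquiv τ x *
            RingOfIntegers.mapAlgEquiv τ (RingOfIntegers.mapAlgEquiv τ x) =
            algebraMap (𝓞 k) (𝓞 L) (((v⁻¹ : (𝓞 k)ˣ) : 𝓞 k) * π i) := by
          rw [map_mul, hx, ← mul_assoc, ← map_mul, Units.inv_mul, map_one, one_mul]
        exact congrArg (algebraMap (𝓞 L) L) h1
      have h2 : π i = v * (((v⁻¹ : (𝓞 k)ˣ) : 𝓞 k) * π i) := by
        rw [← mul_assoc, Units.mul_inv, one_mul]
      rw [h2]
      exact mul_mem (hMu v) ⟨_, hx'⟩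
  exact mul_mem (hMu u) (prod_mem fun i hi ↦ pow_mem (hM i hi) _)

end CyclotomicNine

section KummerIdeals

variable {k K : Type} [Field k] [NumberField k] [IsCyclotomicExtension {3} ℚ k] [Field K]
  [NumberField K] [Algebra k K] {ω : 𝓞 k}

lemma exists_norm_eq_zeta (hω : IsPrimitiveRoot ω 3) {σ : K ≃ₐ[k] K} {θ : K} {D : 𝓞 k}
    (hθ : θ ^ 3 = algebraMap k K D) (hgen : k⟮θ⟯ = ⊤) (hσ : σ θ = algebraMap k K ω * θ)
    (H : Irreducible (Polynomial.X ^ 3 - Polynomial.C (D : k)))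
    {ι : Type*} (s : Finset ι) (π : ι → 𝓞 k) (hπ : ∀ i ∈ s, Prime (π i))
    (hπ' : ∀ i ∈ s, Associated (π i) (1 - ω) ∨ Nat.card (𝓞 k ⧸ Ideal.span {π i}) % 9 = 1)
    (u : (𝓞 k)ˣ) (e : ι → ℕ) (hD : D = u * ∏ i ∈ s, π i ^ e i) :
    ∃ y, y * σ y * σ (σ y) = algebraMap k K ω := by
  let L := CyclotomicField 9 k
  have hω' : IsPrimitiveRoot (ω : k) 3 := hω.map_of_injective RingOfIntegers.coe_injective
  obtain ⟨η, hη, hη'⟩ := exists_pow_three_eq_adjoin_eq_top L hω'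
  have h3 := finrank_cyclotomicExtension_nine k L
  have hH : Irreducible (Polynomial.X ^ 3 - Polynomial.C (ω : k)) := by
    have := irreducible_X_pow_sub_C_of_root_adjoin_eq_top (K := k) (L := L) (a := (ω : k)) (α := η)
      (by rw [h3]; exact hη) hη'
    rwa [h3] at this
  obtain ⟨τ, hτ⟩ := exists_algEquiv_apply_eq_mul hω' hη hH hη'
  obtain ⟨x, hx⟩ := exists_norm_eq_mul_prod hω hη hη' hτ s π hπ hπ' u e
  rw [← hD] at hx
  obtain ⟨pb, hpb⟩ := exists_powerBasis_gen_eq hθ hgen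
  have : FiniteDimensional k L := Module.finite_of_finrank_pos (by omega)
  exact exists_norm_eq_of_norm_eq (by rw [h3, finrank_eq_three_of_adjoin_eq_top hθ H hgen])
    hω'.pow_eq_one pb (by rw [hpb, minpoly_eq_X_pow_three_sub_C hθ H]) (by rw [hpb, hσ]) hη hτ hx
    (algEquiv_apply_three hω' hη hη' hτ)

/-- If `π` divides `D` to an exponent prime to `3`, then `π` is totally ramified in `k(∛D)`. -/
lemma exists_isPrime_pow_three_eq_span (hK : Module.finrank k K = 3) {s : 𝓞 K ≃ₐ[𝓞 k] 𝓞 K}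
    {θ : 𝓞 K} {D π m : 𝓞 k} {a : ℕ} (hθ : θ ^ 3 = algebraMap (𝓞 k) (𝓞 K) D)
    (hω : ω ^ 3 = 1) (hs : s θ = algebraMap (𝓞 k) (𝓞 K) ω * θ) (hπ : Prime π)
    (hD : D = π ^ a * m) (hm : ¬ π ∣ m) (ha : ¬ 3 ∣ a) :
    ∃ P : Ideal (𝓞 K), P.IsPrime ∧ P ^ 3 = Ideal.span {algebraMap (𝓞 k) (𝓞 K) π} ∧
      P.map s = P := by
  have hpid : IsPrincipalIdealRing (𝓞 k) := IsCyclotomicExtension.Rat.three_pid k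
  set f := algebraMap (𝓞 k) (𝓞 K) with hf
  have hfinj : Function.Injective f := FaithfulSMul.algebraMap_injective _ _
  have hfπ : f π ≠ 0 := by rw [Ne, map_eq_zero_iff f hfinj]; exact hπ.ne_zero
  obtain ⟨b, c, hbc⟩ : ∃ b c, a * b = 3 * c + 1 := by
    rcases (by omega : a % 3 = 1 ∨ a % 3 = 2) with h | h
    · exact ⟨1, a / 3, by omega⟩
    · exact ⟨2, (2 * a) / 3, by omega⟩
  obtain ⟨t, ht⟩ : f π ^ c ∣ θ ^ b := by
    rw [← IsIntegrallyClosed.pow_dvd_pow_iff (n := 3) (by norm_num)]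
    refine ⟨f (π * m ^ b), ?_⟩
    rw [← pow_mul, mul_comm b 3, pow_mul, hθ, ← map_pow, hD, ← map_pow, ← map_pow, ← map_mul]
    congr 1
    rw [mul_pow, ← pow_mul, hbc]
    ring
  have ht3 : t ^ 3 = f (π * m ^ b) := by
    apply mul_left_cancel₀ (pow_ne_zero 3 (pow_ne_zero c hfπ))
    rw [← mul_pow, ← ht, ← pow_mul, mul_comm b 3, pow_mul, hθ, ← map_pow, hD, ← map_pow, ← map_pow,
      ← map_mul]
    congr 1
    rw [mul_pow, ← pow_mul, hbc]
    ring
  have hst : s t = f ω ^ b * t := by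
    apply mul_left_cancel₀ (pow_ne_zero c hfπ)
    have h := congrArg s ht
    rw [map_pow, hs, mul_pow, ht, map_mul, map_pow, s.commutes] at h
    rw [← h]; ring
  have hcop : IsCoprime (π ^ 2) (m ^ b) :=
    (hπ.irreducible.coprime_iff_not_dvd.mpr hm).pow
  have hP3 : Ideal.span {f π, t} ^ 3 = Ideal.span {f π} := by
    apply le_antisymm
    · rw [pow_succ, pow_two, Ideal.span_pair_mul_span_pair, Ideal.span_mul_span', Ideal.span_le]
      rintro _ ⟨x, hx, y, hy, rfl⟩
      have h0 : f π ∣ t ^ 3 := ⟨f m ^ b, by rw [ht3, map_mul, map_pow]⟩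
      refine Ideal.mem_span_singleton.mpr ?_
      simp only [Set.mem_insert_iff, Set.mem_singleton_iff] at hx hy
      have e0 : t * t * t = t ^ 3 := by ring
      rcases hx with hx | hx | hx | hx <;> rcases hy with hy | hy <;> simp only [hx, hy]
      all_goals first
        | (simp only [e0]; exact h0)
        | exact ⟨f π * f π, by ring1⟩
        | exact ⟨f π * t, by ring1⟩
        | exact ⟨t * t, by ring1⟩
    · rw [Ideal.span_singleton_le_iff_mem]
      obtain ⟨x, y, hxy⟩ := hcop
      have h1 : f π = f x * f π ^ 3 + f y * t ^ 3 := by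
        rw [ht3, ← map_pow, ← map_mul, ← map_mul, ← map_add]
        refine congrArg f ?_
        linear_combination -π * hxy
      have h2 : f x * f π ^ 3 + f y * t ^ 3 ∈ Ideal.span {f π, t} ^ 3 := add_mem (Ideal.mul_mem_left _ _ (Ideal.pow_mem_pow (Ideal.subset_span (by simp)) 3))
        (Ideal.mul_mem_left _ _ (Ideal.pow_mem_pow (Ideal.subset_span (by simp)) 3))
      rwa [← h1] at h2
  set P := Ideal.span {f π, t} with hP
  have hnorm : Ideal.absNorm P = Ideal.absNorm (Ideal.span {π}) := by
    have h := congrArg Ideal.absNorm hP3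
    rw [map_pow, ← Set.image_singleton, ← Ideal.map_span, Ideal.absNorm_algebraMap] at h
    rw [← IsFractionRing.finrank_eq (𝓞 k) k (𝓞 K) K, hK] at h
    exact Nat.pow_left_injective (by norm_num : 3 ≠ 0) h
  have hprime : (Ideal.span {π}).IsPrime := (Ideal.span_singleton_prime hπ.ne_zero).mpr hπ
  have hmax : (Ideal.span {π}).IsMaximal := hprime.isMaximal (by simpa using hπ.ne_zero)
  have hPtop : P ≠ ⊤ := by
    intro h
    rw [h, Ideal.absNorm_top, eq_comm, Ideal.absNorm_eq_one_iff] at hnorm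
    exact hprime.ne_top hnorm
  have hP0 : P ≠ ⊥ := by
    intro h
    rw [h, Ideal.absNorm_bot, eq_comm, Ideal.absNorm_eq_zero_iff] at hnorm
    exact hπ.ne_zero (by simpa using hnorm)
  have hcomap : P.comap f = Ideal.span {π} := by
    refine (hmax.eq_of_le (fun h ↦ hPtop (Ideal.comap_eq_top_iff.mp h)) ?_).symm
    rw [Ideal.span_singleton_le_iff_mem]
    exact Ideal.subset_span (by simp)
  refine ⟨P, ?_, hP3, ?_⟩
  · have hfin1 : Finite (𝓞 K ⧸ P) := Ideal.finiteQuotientOfFreeOfNeBot _ hP0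
    have hfin2 := finite_quotient_span_of_prime hπ
    let g : 𝓞 k ⧸ Ideal.span {π} →+* 𝓞 K ⧸ P := Ideal.quotientMap P f hcomap.ge
    have hg : Function.Injective g := Ideal.quotientMap_injective' hcomap.le
    have hg' : Function.Bijective g := by
      rw [Nat.bijective_iff_injective_and_card]
      exact ⟨hg, hnorm.symm⟩
    have : IsDomain (𝓞 k ⧸ Ideal.span {π}) := Ideal.Quotient.isDomain _
    have := (RingEquiv.ofBijective g hg').symm.toMulEquiv.isDomain
    exact (Ideal.Quotient.isDomain_iff_prime P).mp inferInstance
  · have hωu : IsUnit (f ω ^ b) := by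
      refine IsUnit.pow _ (IsUnit.map _ (IsUnit.of_mul_eq_one (ω ^ 2) ?_))
      rw [← hω]; ring
    rw [hP, Ideal.map_span, Set.image_pair, s.commutes, hst, Ideal.span_insert, Ideal.span_insert,
      Ideal.span_singleton_mul_left_unit hωu]

end KummerIdeals

section KummerMain

variable {k K : Type} [Field k] [NumberField k] [IsCyclotomicExtension {3} ℚ k] [Field K]
  [NumberField K] [Algebra k K] {ω : 𝓞 k}

lemma prime_one_sub (hω : IsPrimitiveRoot ω 3) : Prime (1 - ω) := by
  have hω' : IsPrimitiveRoot (ω : k) 3 := hω.map_of_injective RingOfIntegers.coe_injective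
  have h := hω'.zeta_sub_one_prime'
  have h2 : hω'.toInteger = ω := rfl
  rw [h2] at h
  rw [← neg_sub]
  exact h.neg

/-- If the exponent of the prime `π` in `D` is not a multiple of `3`, then `D` is not a cube. -/
lemma irreducible_X_pow_three_sub_C {D π m : 𝓞 k} {a : ℕ} (hπ : Prime π) (hD : D = π ^ a * m)
    (hm : ¬ π ∣ m) (ha : ¬ 3 ∣ a) :
    Irreducible (Polynomial.X ^ 3 - Polynomial.C (D : k)) := by
  refine X_pow_sub_C_irreducible_of_prime Nat.prime_three fun b hb ↦ ?_
  have hbi : IsIntegral ℤ b := by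
    have : IsIntegral ℤ (b ^ 3) := by rw [hb]; exact RingOfIntegers.isIntegral_coe D
    exact this.of_pow (by norm_num)
  obtain ⟨c, rfl⟩ : ∃ c : 𝓞 k, (c : k) = b := ⟨⟨b, hbi⟩, rfl⟩
  have hc : c ^ 3 = D := RingOfIntegers.ext (by simpa using hb)
  have hm0 : m ≠ 0 := by rintro rfl; exact hm (dvd_zero _)
  have hc0 : c ≠ 0 := by
    rintro rfl
    rw [hD, zero_pow (by norm_num), eq_comm, mul_eq_zero] at hc
    exact hc.elim (pow_ne_zero a hπ.ne_zero) hm0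
  have h1 : emultiplicity π (c ^ 3) = a := by
    rw [hc, hD, emultiplicity_mul hπ, emultiplicity_pow_self hπ.ne_zero hπ.not_isUnit,
      emultiplicity_eq_zero.mpr hm, add_zero]
  have hfin : FiniteMultiplicity π c := FiniteMultiplicity.of_prime_left hπ hc0
  rw [emultiplicity_pow hπ, hfin.emultiplicity_eq_multiplicity] at h1
  exact ha ⟨_, (by exact_mod_cast h1.symm)⟩

lemma Units.rank_eq_two_of_finrank_eq_three (hω : IsPrimitiveRoot ω 3)
    (hK : Module.finrank k K = 3) : Units.rank K = 2 := by
  have hω' : IsPrimitiveRoot (algebraMap k K ω) 3 :=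
    (hω.map_of_injective RingOfIntegers.coe_injective).map_of_injective (algebraMap k K).injective
  have h2 : Module.finrank ℚ k = 2 := by
    rw [IsCyclotomicExtension.finrank (n := 3) k
      (Polynomial.cyclotomic.irreducible_rat (by norm_num))]
    rfl
  have h6 : Module.finrank ℚ K = 6 := by
    rw [← Module.finrank_mul_finrank ℚ k K, h2, hK]
  have h0 := InfinitePlace.IsPrimitiveRoot.nrRealPlaces_eq_zero_of_two_lt (by norm_num) hω'
  have h1 := InfinitePlace.card_add_two_mul_card_eq_rank K
  have h3 := InfinitePlace.card_eq_nrRealPlaces_add_nrComplexPlaces K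
  rw [Units.rank]
  omega

/-- A Kummer extension `k(∛D)` is unramified at the primes not dividing `3D`. -/
lemma mem_span_of_pow_mem_of_not_dvd (hω : IsPrimitiveRoot ω 3) {s : 𝓞 K ≃ₐ[𝓞 k] 𝓞 K} {θ : 𝓞 K}
    {D q : 𝓞 k} (hs3 : ∀ x, s (s (s x)) = x)
    (hfix : ∀ x, s x = x → ∃ a, algebraMap (𝓞 k) (𝓞 K) a = x)
    (hθ : θ ^ 3 = algebraMap (𝓞 k) (𝓞 K) D) (hs : s θ = algebraMap (𝓞 k) (𝓞 K) ω * θ)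
    (hq : Prime q) (hqD : ¬ q ∣ D) (hqω : ¬ q ∣ 1 - ω) {x : 𝓞 K} {n : ℕ}
    (hx : x ^ n ∈ Ideal.span {algebraMap (𝓞 k) (𝓞 K) q}) :
    x ∈ Ideal.span {algebraMap (𝓞 k) (𝓞 K) q} := by
  have hpid : IsPrincipalIdealRing (𝓞 k) := IsCyclotomicExtension.Rat.three_pid k
  refine mem_span_of_pow_mem_of_isCoprime (s : 𝓞 K →ₐ[𝓞 k] 𝓞 K) hs3 hfix hq
    (δ := (1 - ω) ^ 3 * D) (y := θ) ?_ ?_ hx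
  · refine hq.irreducible.coprime_iff_not_dvd.mpr fun h ↦ ?_
    exact (hq.dvd_or_dvd h).elim (fun h ↦ hqω (hq.dvd_of_dvd_pow h)) hqD
  · have h3 : algebraMap (𝓞 k) (𝓞 K) ω ^ 3 = 1 := by rw [← map_pow, hω.pow_eq_one, map_one]
    change (θ - s θ) * (s θ - s (s θ)) * (s (s θ) - θ) = _
    simp only [hs, map_mul, s.commutes, map_pow, map_sub, map_one, ← hθ]
    linear_combination (θ ^ 3 * (1 - algebraMap (𝓞 k) (𝓞 K) ω) ^ 2) * h3

/-- If `D` is congruent to a cube modulo `(1 - ω) ^ 3` and prime to `1 - ω`, then the Kummer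
extension `k(∛D)` is unramified at `1 - ω`. -/
lemma mem_span_of_pow_mem_of_dvd_sub (hω : IsPrimitiveRoot ω 3) {s : 𝓞 K ≃ₐ[𝓞 k] 𝓞 K} {θ : 𝓞 K}
    {D q ε : 𝓞 k} (hs3 : ∀ x, s (s (s x)) = x)
    (hfix : ∀ x, s x = x → ∃ a, algebraMap (𝓞 k) (𝓞 K) a = x)
    (hθ : θ ^ 3 = algebraMap (𝓞 k) (𝓞 K) D) (hs : s θ = algebraMap (𝓞 k) (𝓞 K) ω * θ)
    (hq : Prime q) (hqD : ¬ q ∣ D) (hε : (1 - ω) ^ 3 ∣ D - ε ^ 3) {x : 𝓞 K} {n : ℕ}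
    (hx : x ^ n ∈ Ideal.span {algebraMap (𝓞 k) (𝓞 K) q}) :
    x ∈ Ideal.span {algebraMap (𝓞 k) (𝓞 K) q} := by
  have hpid : IsPrincipalIdealRing (𝓞 k) := IsCyclotomicExtension.Rat.three_pid k
  set f := algebraMap (𝓞 k) (𝓞 K) with hf
  have hfinj : Function.Injective f := FaithfulSMul.algebraMap_injective _ _
  have h3 : f ω ^ 3 = 1 := by rw [← map_pow, hω.pow_eq_one, map_one]
  have h1 : 1 + f ω + f ω ^ 2 = 0 := by
    rw [← map_pow, ← map_one f, ← map_add, ← map_add, one_add_add_sq_eq_zero hω, map_zero]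
  obtain ⟨c, hc⟩ := hε
  have hl0 : 1 - f ω ≠ 0 := by
    rw [← map_one f, ← map_sub, Ne, map_eq_zero_iff f hfinj]; exact (prime_one_sub hω).ne_zero
  have hl0' : ((1 - f ω : 𝓞 K) : K) ≠ 0 := by
    rwa [Ne, RingOfIntegers.coe_eq_zero_iff]
  obtain ⟨y, hy⟩ : ∃ y, θ = (1 - f ω) * y + f ε := by
    have hc' := congrArg f hc
    simp only [map_sub, map_mul, map_pow, map_one, ← hθ] at hc'
    have hz : IsIntegral (𝓞 K) (((θ - f ε : 𝓞 K) : K) / ((1 - f ω : 𝓞 K) : K)) := by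
      refine ⟨Polynomial.X ^ 3 + Polynomial.C (-f ε * f ω ^ 2 * (1 - f ω)) * Polynomial.X ^ 2 +
        Polynomial.C (- f ε ^ 2 * f ω ^ 2) * Polynomial.X + Polynomial.C (-f c), by monicity!, ?_⟩
      simp only [Polynomial.eval₂_add, Polynomial.eval₂_mul, Polynomial.eval₂_pow,
        Polynomial.eval₂_X, Polynomial.eval₂_C, div_pow]
      field_simp
      have h3' : (3 : 𝓞 K) = - f ω ^ 2 * (1 - f ω) ^ 2 := by
        linear_combination (f ω - 2) * h3 + h1
      have : (θ - f ε) ^ 3 + (-f ε * f ω ^ 2 * (1 - f ω)) * (θ - f ε) ^ 2 * (1 - f ω) +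
        (- f ε ^ 2 * f ω ^ 2) * (θ - f ε) * (1 - f ω) ^ 2 + (-f c) * (1 - f ω) ^ 3 = 0 := by
        linear_combination hc' - ((θ - f ε) ^ 2 * f ε + (θ - f ε) * f ε ^ 2) * h3'
      have := congrArg (algebraMap (𝓞 K) K) this
      simp only [map_add, map_mul, map_zero, map_pow] at this ⊢
      linear_combination this
    obtain ⟨y, hy⟩ := IsIntegrallyClosed.isIntegral_iff.mp hz
    refine ⟨y, RingOfIntegers.ext ?_⟩
    rw [eq_div_iff hl0'] at hy
    simp only [map_sub, map_add, map_mul] at hy ⊢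
    linear_combination -hy
  have hys : y - s y = θ := by
    apply mul_left_cancel₀ hl0
    have h := congrArg s hy
    simp only [map_add, map_mul, map_sub, map_one, hf, s.commutes, hs] at h
    rw [← hf] at h
    linear_combination h - hy
  refine mem_span_of_pow_mem_of_isCoprime (s : 𝓞 K →ₐ[𝓞 k] 𝓞 K) hs3 hfix hq
    (δ := D) (y := y) (hq.irreducible.coprime_iff_not_dvd.mpr hqD) ?_ hx
  change (y - s y) * (s y - s (s y)) * (s (s y) - y) = _
  have h1' : s y - s (s y) = s θ := by rw [← hys, map_sub]
  have h2' : s (s y) - y = s (s θ) := by rw [← hys, map_sub, map_sub, hs3]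
  rw [hys, h1', h2', hs, map_mul, s.commutes, hs, ← hf, ← hθ]
  linear_combination θ ^ 3 * h3

/-- A Kummer extension `k(∛D)` of `k = ℚ(ζ₃)` with exactly three ramified primes, each of which is
`1 - ω` or has norm congruent to `1` modulo `9`. -/
theorem exists_isCubicExtensionRamifiedAtThreePrimes (hω : IsPrimitiveRoot ω 3) {σ : K ≃ₐ[k] K}
    {θ : 𝓞 K} {D : 𝓞 k} (hθ : θ ^ 3 = algebraMap (𝓞 k) (𝓞 K) D) (hgen : k⟮(θ : K)⟯ = ⊤)
    (hσ : σ θ = algebraMap k K ω * θ) {π : Fin 3 → 𝓞 k} (hπ : ∀ i, Prime (π i))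
    (hassoc : ∀ i j, Associated (π i) (π j) → i = j)
    (hπ' : ∀ i, Associated (π i) (1 - ω) ∨ Nat.card (𝓞 k ⧸ Ideal.span {π i}) % 9 = 1)
    (u : (𝓞 k)ˣ) {a : Fin 3 → ℕ} (ha : ∀ i, ¬ 3 ∣ a i) (hD : D = u * ∏ i, π i ^ a i)
    (hram : (∃ i, Associated (π i) (1 - ω)) ∨ ∃ ε, (1 - ω) ^ 3 ∣ D - ε ^ 3) :
    ∃ P, IsCubicExtensionRamifiedAtThreePrimes σ (ω : k) π P := by
  have hω' : IsPrimitiveRoot (ω : k) 3 := hω.map_of_injective RingOfIntegers.coe_injective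
  have hθ' : (θ : K) ^ 3 = algebraMap k K D := by
    have := congrArg (algebraMap (𝓞 K) K) hθ
    rw [map_pow] at this
    exact this
  have hdvd (q : 𝓞 k) (hq : Prime q) (h : q ∣ D) : ∃ i, Associated q (π i) := by
    rw [hD] at h
    rcases hq.dvd_or_dvd h with h | h
    · exact absurd (isUnit_of_dvd_unit h u.isUnit) hq.not_isUnit
    · obtain ⟨i, -, hi⟩ := (hq.dvd_finsetProd_iff _).mp h
      exact ⟨i, hq.associated_of_dvd (hπ i) (hq.dvd_of_dvd_pow hi)⟩
  have hsplit (i) : ∃ m, D = π i ^ a i * m ∧ ¬ π i ∣ m := by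
    refine ⟨u * ∏ j ∈ Finset.univ.erase i, π j ^ a j, ?_, fun h ↦ ?_⟩
    · rw [hD, ← Finset.mul_prod_erase _ _ (Finset.mem_univ i)]; ring
    · rcases (hπ i).dvd_or_dvd h with h | h
      · exact absurd (isUnit_of_dvd_unit h u.isUnit) (hπ i).not_isUnit
      · obtain ⟨j, hj, hij⟩ := ((hπ i).dvd_finsetProd_iff _).mp h
        exact Finset.ne_of_mem_erase hj
          (hassoc i j ((hπ i).associated_of_dvd (hπ j) ((hπ i).dvd_of_dvd_pow hij))).symm
  have H : Irreducible (Polynomial.X ^ 3 - Polynomial.C (D : k)) := by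
    obtain ⟨m, hm, hm'⟩ := hsplit 0
    exact irreducible_X_pow_three_sub_C (hπ 0) hm hm' (ha 0)
  have hK := finrank_eq_three_of_adjoin_eq_top hθ' H hgen
  set s := RingOfIntegers.mapAlgEquiv σ with hs_def
  have hs : s θ = algebraMap (𝓞 k) (𝓞 K) ω * θ := RingOfIntegers.ext hσ
  have hσ3 := algEquiv_apply_three hω' hθ' hgen hσ
  have hs3 (x) : s (s (s x)) = x := RingOfIntegers.ext (hσ3 x)
  have hfix (x) (hx : σ x = x) : ∃ a, algebraMap k K a = x :=
    exists_algebraMap_eq_of_apply_eq hω' hθ' H hgen hσ hx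
  have hsfix (x) (hx : s x = x) : ∃ a, algebraMap (𝓞 k) (𝓞 K) a = x := by
    obtain ⟨a, ha⟩ := hfix x (congrArg (algebraMap (𝓞 K) K) hx)
    have hai : IsIntegral ℤ a := by
      rw [← isIntegral_algebraMap_iff (algebraMap k K).injective, ha]
      exact RingOfIntegers.isIntegral_coe x
    exact ⟨⟨a, hai⟩, RingOfIntegers.ext ha⟩
  have hP (i) : ∃ P : Ideal (𝓞 K), P.IsPrime ∧ P ^ 3 = Ideal.span {algebraMap (𝓞 k) (𝓞 K) (π i)} ∧
      P.map s = P := by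
    obtain ⟨m, hm, hm'⟩ := hsplit i
    exact exists_isPrime_pow_three_eq_span hK hθ hω.pow_eq_one hs (hπ i) hm hm' (ha i)
  choose P hP1 hP2 hP3 using hP
  refine ⟨P, hσ3, hfix, fun x hx ↦ exists_apply_eq_mul_of_norm_eq_one hω' hθ' H hgen hσ hx, hω',
    exists_norm_eq_zeta hω hθ' hgen hσ H Finset.univ π (fun i _ ↦ hπ i) (fun i _ ↦ hπ' i) u a hD,
    fun v ↦ ?_, IsCyclotomicExtension.Rat.three_pid k, Units.rank_eq_two_of_finrank_eq_three hω hK,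
    hπ, hassoc, hP1, hP2, hP3, fun q hq hqi x n hx ↦ ?_⟩
  · obtain ⟨n, hn⟩ := exists_unit_eq_neg_pow hω v
    exact ⟨n, by rw [hn]; simp⟩
  · have hqD : ¬ q ∣ D := fun h ↦ by
      obtain ⟨i, hi⟩ := hdvd q hq h
      exact hqi i hi
    by_cases hqω : q ∣ 1 - ω
    · have hqω' : Associated q (1 - ω) := hq.associated_of_dvd (prime_one_sub hω) hqω
      rcases hram with ⟨i, hi⟩ | ⟨ε, hε⟩
      · exact absurd (hqω'.trans hi.symm) (hqi i)
      · exact mem_span_of_pow_mem_of_dvd_sub hω hs3 hsfix hθ hs hq hqD hε hx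
    · exact mem_span_of_pow_mem_of_not_dvd hω hs3 hsfix hθ hs hq hqD hqω hx

end KummerMain

section EisensteinPrimes

variable {k : Type} [Field k] [NumberField k] [IsCyclotomicExtension {3} ℚ k] {ω : 𝓞 k}

lemma liesOver_span_of_prime_dvd {q : ℕ} (hq : q.Prime) {π : 𝓞 k} (hπ : Prime π)
    (h : π ∣ (q : 𝓞 k)) : (Ideal.span {π}).LiesOver (Ideal.span {(q : ℤ)}) := by
  have hP : (Ideal.span {π}).IsPrime := (Ideal.span_singleton_prime hπ.ne_zero).mpr hπ
  have hmax : (Ideal.span {(q : ℤ)}).IsMaximal :=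
    PrincipalIdealRing.isMaximal_of_irreducible (Nat.prime_iff_prime_int.mp hq).irreducible
  refine ⟨hmax.eq_of_le (hP.comap _).ne_top ?_⟩
  rw [Ideal.span_singleton_le_iff_mem, Ideal.under, Ideal.mem_comap, Ideal.mem_span_singleton]
  simpa using h

lemma card_quotient_of_prime_dvd {q : ℕ} (hq : q.Prime) (hq3 : q ≠ 3) {π : 𝓞 k} (hπ : Prime π)
    (h : π ∣ (q : 𝓞 k)) : Nat.card (𝓞 k ⧸ Ideal.span {π}) = q ^ orderOf (q : ZMod 3) := by
  have := Fact.mk hq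
  have hP : (Ideal.span {π}).IsPrime := (Ideal.span_singleton_prime hπ.ne_zero).mpr hπ
  have hover := liesOver_span_of_prime_dvd hq hπ h
  have hmax : (Ideal.span {(q : ℤ)}).IsMaximal :=
    PrincipalIdealRing.isMaximal_of_irreducible (Nat.prime_iff_prime_int.mp hq).irreducible
  have hmax' : (Ideal.span {π}).IsMaximal := hP.isMaximal (by simpa using hπ.ne_zero)
  have h1 := Ideal.absNorm_eq_pow_inertiaDeg' (Ideal.span {π}) hq
  rw [Ideal.inertiaDeg'_eq_inertiaDeg, IsCyclotomicExtension.Rat.inertiaDeg_eq_of_not_dvd q k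
    (m := 3) _ (fun h ↦ hq3 ((Nat.prime_dvd_prime_iff_eq hq Nat.prime_three).mp h)),
    Ideal.absNorm_apply, Submodule.cardQuot_apply] at h1
  exact h1

lemma not_sq_dvd_of_prime {q : ℕ} (hq : q.Prime) (hq3 : q ≠ 3) {π : 𝓞 k} (hπ : Prime π)
    (h : π ∣ (q : 𝓞 k)) : ¬ π ^ 2 ∣ (q : 𝓞 k) := by
  have := Fact.mk hq
  have hP : (Ideal.span {π}).IsPrime := (Ideal.span_singleton_prime hπ.ne_zero).mpr hπ
  have hover := liesOver_span_of_prime_dvd hq hπ h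
  have hmap : (Ideal.span {(q : ℤ)}).map (algebraMap ℤ (𝓞 k)) = Ideal.span {(q : 𝓞 k)} := by
    rw [Ideal.map_span, Set.image_singleton]; simp
  have h1 := IsCyclotomicExtension.Rat.ramificationIdx_eq_of_not_dvd q k (Ideal.span {π})
    (m := 3) (fun h ↦ hq3 ((Nat.prime_dvd_prime_iff_eq hq Nat.prime_three).mp h))
  rw [← Ideal.ramificationIdx'_eq_ramificationIdx (Ideal.span {(q : ℤ)}) (Ideal.span {π})
    (by simpa using hq.ne_zero)] at h1
  intro h2
  refine (Ideal.ramificationIdx'_ne_one_iff (p := Ideal.span {(q : ℤ)}) (P := Ideal.span {π})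
    ?_).mpr ?_ h1
  · rw [hmap, Ideal.span_singleton_le_span_singleton]; exact h
  · rw [hmap, Ideal.span_singleton_pow, Ideal.span_singleton_le_span_singleton]; exact h2

lemma card_quotient_natCast (q : ℕ) : Nat.card (𝓞 k ⧸ Ideal.span {(q : 𝓞 k)}) = q ^ 2 := by
  have h2 : Module.finrank ℚ k = 2 := by
    rw [IsCyclotomicExtension.finrank (n := 3) k
      (Polynomial.cyclotomic.irreducible_rat (by norm_num))]
    rfl
  rw [← Submodule.cardQuot_apply, ← Ideal.absNorm_apply, Ideal.absNorm_span_natCast,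
    RingOfIntegers.rank, h2]

lemma exists_prime_dvd_natCast {q : ℕ} (hq : q.Prime) : ∃ π : 𝓞 k, Prime π ∧ π ∣ (q : 𝓞 k) := by
  have hpid : IsPrincipalIdealRing (𝓞 k) := IsCyclotomicExtension.Rat.three_pid k
  obtain ⟨π, hπ, h⟩ := WfDvdMonoid.exists_irreducible_factor (a := (q : 𝓞 k)) (fun hu ↦ by
    have h := card_quotient_natCast (k := k) q
    rw [← Submodule.cardQuot_apply, Ideal.span_singleton_eq_top.mpr hu, Submodule.cardQuot_top] at h
    exact hq.ne_one (by simpa using h.symm)) (by exact_mod_cast hq.ne_zero)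
  exact ⟨π, hπ.prime, h⟩

lemma card_quotient_mul (a b : 𝓞 k) : Nat.card (𝓞 k ⧸ Ideal.span {a * b}) =
    Nat.card (𝓞 k ⧸ Ideal.span {a}) * Nat.card (𝓞 k ⧸ Ideal.span {b}) := by
  simp_rw [← Submodule.cardQuot_apply, ← Ideal.absNorm_apply]
  rw [← Ideal.span_singleton_mul_span_singleton, map_mul]

/-- A prime number `p ≡ 1 (mod 3)` splits in `ℚ(ζ₃)`. -/
lemma exists_prime_mul_prime {p : ℕ} (hp : p.Prime) (hp1 : p % 3 = 1) :
    ∃ π₁ π₂ : 𝓞 k, Prime π₁ ∧ Prime π₂ ∧ ¬ Associated π₁ π₂ ∧ (p : 𝓞 k) = π₁ * π₂ ∧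
      Nat.card (𝓞 k ⧸ Ideal.span {π₁}) = p ∧ Nat.card (𝓞 k ⧸ Ideal.span {π₂}) = p := by
  have hp3 : p ≠ 3 := by omega
  have h1 : orderOf (p : ZMod 3) = 1 := by
    rw [orderOf_eq_one_iff]
    exact (ZMod.natCast_eq_natCast_iff' p 1 3).mpr (by omega) |>.trans Nat.cast_one
  obtain ⟨π, hπ, b, hb⟩ := exists_prime_dvd_natCast (k := k) hp
  have hc := card_quotient_of_prime_dvd hp hp3 hπ ⟨b, hb⟩
  rw [h1, pow_one] at hc
  have hcb : Nat.card (𝓞 k ⧸ Ideal.span {b}) = p := by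
    have := card_quotient_natCast (k := k) p
    rw [hb, card_quotient_mul, hc, sq] at this
    exact Nat.eq_of_mul_eq_mul_left hp.pos this
  refine ⟨π, b, hπ, Ideal.prime_of_irreducible_absNorm_span ?_ ?_, ?_, hb, hc, hcb⟩
  · rintro rfl
    rw [mul_zero] at hb
    exact hp.ne_zero (by exact_mod_cast hb)
  · rw [Ideal.absNorm_apply, Submodule.cardQuot_apply, hcb]
    exact hp
  · rintro h
    refine not_sq_dvd_of_prime hp hp3 hπ ⟨b, hb⟩ ?_
    rw [hb, sq]
    exact mul_dvd_mul_left _ h.dvd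

/-- A prime number `q ≡ 2 (mod 3)` is inert in `ℚ(ζ₃)`. -/
lemma prime_natCast_of_mod_three {q : ℕ} (hq : q.Prime) (hq2 : q % 3 = 2) :
    Prime (q : 𝓞 k) := by
  have hq3 : q ≠ 3 := by omega
  have h1 : orderOf (q : ZMod 3) = 2 := by
    rw [(ZMod.natCast_eq_natCast_iff' q 2 3).mpr (by omega)]
    exact orderOf_eq_prime (by decide) (by decide)
  obtain ⟨π, hπ, b, hb⟩ := exists_prime_dvd_natCast (k := k) hq
  have hc := card_quotient_of_prime_dvd hq hq3 hπ ⟨b, hb⟩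
  rw [h1] at hc
  have hcb : Nat.card (𝓞 k ⧸ Ideal.span {b}) = 1 := by
    have := card_quotient_natCast (k := k) q
    rw [hb, card_quotient_mul, hc] at this
    exact Nat.eq_of_mul_eq_mul_left (pow_pos hq.pos 2) (this.trans (mul_one _).symm)
  rw [← Submodule.cardQuot_apply, ← Ideal.absNorm_apply, Ideal.absNorm_eq_one_iff,
    Ideal.span_singleton_eq_top] at hcb
  rw [hb]
  exact (associated_mul_unit_right π b hcb).prime hπ

lemma not_associated_of_dvd_natCast {m n : ℕ} (hmn : m.Coprime n) {π ρ : 𝓞 k} (hπ : Prime π)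
    (hm : π ∣ (m : 𝓞 k)) (hn : ρ ∣ (n : 𝓞 k)) : ¬ Associated π ρ := by
  intro h
  refine hπ.not_isUnit (IsCoprime.isUnit_of_dvd' ?_ hm (h.dvd.trans hn))
  simpa using (Nat.isCoprime_iff_coprime.mpr hmn).map (algebraMap ℤ (𝓞 k))

lemma three_eq_mul_sq (hω : IsPrimitiveRoot ω 3) : (3 : 𝓞 k) = -ω ^ 2 * (1 - ω) ^ 2 := by
  linear_combination (ω - 2) * hω.pow_eq_one + one_add_add_sq_eq_zero hω

end EisensteinPrimes

section Radicands

variable {k : Type} [Field k] [NumberField k] [IsCyclotomicExtension {3} ℚ k] {ω : 𝓞 k}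

/-- `D` has exactly three prime divisors up to units, each of them `1 - ω` or of norm congruent to
`1` modulo `9`, with exponents prime to `3`; and `1 - ω` is one of them or `D` is a cube modulo
`(1 - ω) ^ 3`. -/
def IsThreePrimeRadicand (ω D : 𝓞 k) : Prop :=
  ∃ (π : Fin 3 → 𝓞 k) (u : (𝓞 k)ˣ) (a : Fin 3 → ℕ), (∀ i, Prime (π i)) ∧
    (∀ i j, Associated (π i) (π j) → i = j) ∧
    (∀ i, Associated (π i) (1 - ω) ∨ Nat.card (𝓞 k ⧸ Ideal.span {π i}) % 9 = 1) ∧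
    (∀ i, ¬ 3 ∣ a i) ∧ D = u * ∏ i, π i ^ a i ∧
    ((∃ i, Associated (π i) (1 - ω)) ∨ ∃ ε, (1 - ω) ^ 3 ∣ D - ε ^ 3)

lemma isThreePrimeRadicand_of_eq_mul {D π₀ π₁ π₂ : 𝓞 k} {a₀ a₁ a₂ : ℕ} {u : 𝓞 k} (hu : IsUnit u)
    (h₀ : Prime π₀) (h₁ : Prime π₁) (h₂ : Prime π₂) (h₀₁ : ¬ Associated π₀ π₁)
    (h₀₂ : ¬ Associated π₀ π₂) (h₁₂ : ¬ Associated π₁ π₂)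
    (hc₀ : Associated π₀ (1 - ω) ∨ Nat.card (𝓞 k ⧸ Ideal.span {π₀}) % 9 = 1)
    (hc₁ : Nat.card (𝓞 k ⧸ Ideal.span {π₁}) % 9 = 1)
    (hc₂ : Nat.card (𝓞 k ⧸ Ideal.span {π₂}) % 9 = 1)
    (ha₀ : ¬ 3 ∣ a₀) (ha₁ : ¬ 3 ∣ a₁) (ha₂ : ¬ 3 ∣ a₂)
    (hD : D = u * (π₀ ^ a₀ * π₁ ^ a₁ * π₂ ^ a₂))
    (hram : Associated π₀ (1 - ω) ∨ ∃ ε, (1 - ω) ^ 3 ∣ D - ε ^ 3) : IsThreePrimeRadicand ω D := by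
  refine ⟨![π₀, π₁, π₂], hu.unit, ![a₀, a₁, a₂], ?_, ?_, ?_, ?_, ?_, ?_⟩
  · simp [Fin.forall_fin_succ, h₀, h₁, h₂]
  · have h₁₀ := fun h ↦ h₀₁ (Associated.symm h)
    have h₂₀ := fun h ↦ h₀₂ (Associated.symm h)
    have h₂₁ := fun h ↦ h₁₂ (Associated.symm h)
    intro i j hij
    fin_cases i <;> fin_cases j <;> first | rfl | exact absurd hij (by assumption)
  · intro i
    fin_cases i
    exacts [hc₀, Or.inr hc₁, Or.inr hc₂]
  · simp [Fin.forall_fin_succ, ha₀, ha₁, ha₂]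
  · simpa [Fin.prod_univ_three] using hD
  · exact hram.imp_left fun h ↦ ⟨0, h⟩

lemma exists_dvd_sub_pow_three (hω : IsPrimitiveRoot ω 3) {d : ℕ} (hd : d % 9 = 1 ∨ d % 9 = 8) :
    ∃ ε, (1 - ω) ^ 3 ∣ (d : 𝓞 k) - ε ^ 3 := by
  have h9 : (9 : 𝓞 k) = (1 - ω) ^ 3 * (ω * (1 - ω)) := by
    rw [show (9 : 𝓞 k) = 3 * 3 by norm_num, three_eq_mul_sq hω]
    linear_combination (ω * (1 - ω) ^ 4) * hω.pow_eq_one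
  have h : (1 - ω) ^ 3 ∣ (9 : 𝓞 k) := ⟨_, h9⟩
  have hd' : (d : 𝓞 k) = 9 * (d / 9 : ℕ) + (d % 9 : ℕ) := by
    exact_mod_cast (Nat.div_add_mod d 9).symm
  rcases hd with hd | hd
  · refine ⟨1, h.trans ⟨(d / 9 : ℕ), ?_⟩⟩
    rw [hd', hd]; push_cast; ring
  · refine ⟨-1, h.trans ⟨(d / 9 : ℕ) + 1, ?_⟩⟩
    rw [hd', hd]; push_cast; ring

lemma not_associated_one_sub_of_card (hω : IsPrimitiveRoot ω 3) {π : 𝓞 k} (hπ : Prime π)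
    (hcard : Nat.card (𝓞 k ⧸ Ideal.span {π}) % 9 = 1) : ¬ Associated (1 - ω) π :=
  fun h ↦ hπ.not_isUnit ((isCoprime_one_sub_of_card hω hπ hcard).isUnit_of_dvd' dvd_rfl h.symm.dvd)

lemma card_quotient_natCast_mod_nine {q : ℕ} (hq : q % 9 = 8) :
    Nat.card (𝓞 k ⧸ Ideal.span {(q : 𝓞 k)}) % 9 = 1 := by
  rw [card_quotient_natCast, Nat.pow_mod, hq]

lemma not_associated_natCast {p q : ℕ} (hp : p.Prime) (hq : q.Prime) (hpq : p ≠ q)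
    {π ρ : 𝓞 k} (hπ : Prime π) (hπp : π ∣ (p : 𝓞 k)) (hρq : ρ ∣ (q : 𝓞 k)) : ¬ Associated π ρ :=
  not_associated_of_dvd_natCast ((Nat.coprime_primes hp hq).mpr hpq) hπ hπp hρq

lemma isThreePrimeRadicand_three_mul (hω : IsPrimitiveRoot ω 3) {p e e₁ : ℕ} (hp : p.Prime)
    (hp1 : p % 9 = 1) (he : e = 1 ∨ e = 2) (he₁ : e₁ = 1 ∨ e₁ = 2) :
    IsThreePrimeRadicand ω ((3 ^ e * p ^ e₁ : ℕ) : 𝓞 k) := by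
  obtain ⟨π₁, π₂, h₁, h₂, h₁₂, h, hc₁, hc₂⟩ := exists_prime_mul_prime (k := k) hp (by omega)
  rw [← hc₁] at hp1
  refine isThreePrimeRadicand_of_eq_mul (a₀ := 2 * e) (a₁ := e₁) (a₂ := e₁) (π₀ := 1 - ω)
    (((hω.isUnit (by norm_num)).pow 2).neg.pow e) (prime_one_sub hω) h₁ h₂
    (not_associated_one_sub_of_card hω h₁ hp1)
    (not_associated_one_sub_of_card hω h₂ (by rwa [hc₂, ← hc₁])) h₁₂ (Or.inl (Associated.refl _))
    hp1 (by rwa [hc₂, ← hc₁]) (by omega) (by omega) (by omega) ?_ (Or.inl (Associated.refl _))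
  push_cast
  rw [h, three_eq_mul_sq hω, mul_pow _ ((1 - ω) ^ 2), ← pow_mul]
  ring

lemma isThreePrimeRadicand_mul (hω : IsPrimitiveRoot ω 3) {p q e₁ f₁ : ℕ} (hp : p.Prime)
    (hq : q.Prime) (hp1 : p % 9 = 1) (hq8 : q % 9 = 8) (he₁ : e₁ = 1 ∨ e₁ = 2)
    (hf₁ : f₁ = 1 ∨ f₁ = 2)
    (hd : (p ^ e₁ * q ^ f₁) % 9 = 1 ∨ (p ^ e₁ * q ^ f₁) % 9 = 8) :
    IsThreePrimeRadicand ω ((p ^ e₁ * q ^ f₁ : ℕ) : 𝓞 k) := by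
  obtain ⟨π₁, π₂, h₁, h₂, h₁₂, h, hc₁, hc₂⟩ := exists_prime_mul_prime (k := k) hp (by omega)
  have hpq : p ≠ q := by rintro rfl; omega
  have hp1' := hp1
  rw [← hc₁] at hp1
  rw [← hc₂] at hp1'
  refine isThreePrimeRadicand_of_eq_mul (a₀ := e₁) (a₁ := e₁) (a₂ := f₁) (π₂ := q) isUnit_one
    h₁ h₂ (prime_natCast_of_mod_three hq (by omega)) h₁₂
    (not_associated_natCast hp hq hpq h₁ ⟨_, h⟩ dvd_rfl)
    (not_associated_natCast hp hq hpq h₂ ⟨π₁, h.trans (mul_comm _ _)⟩ dvd_rfl) (Or.inr hp1) hp1'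
    (card_quotient_natCast_mod_nine hq8) (by omega) (by omega) (by omega) ?_
    (Or.inr (exists_dvd_sub_pow_three hω hd))
  push_cast
  rw [h]
  ring

lemma isThreePrimeRadicand_three_mul_mul (hω : IsPrimitiveRoot ω 3) {q₁ q₂ e f₁ f₂ : ℕ}
    (hq₁ : q₁.Prime) (hq₂ : q₂.Prime) (hne : q₁ ≠ q₂) (h₁ : q₁ % 9 = 8) (h₂ : q₂ % 9 = 8)
    (he : e = 1 ∨ e = 2) (hf₁ : f₁ = 1 ∨ f₁ = 2) (hf₂ : f₂ = 1 ∨ f₂ = 2) :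
    IsThreePrimeRadicand ω ((3 ^ e * q₁ ^ f₁ * q₂ ^ f₂ : ℕ) : 𝓞 k) := by
  have hp₁ : Prime (q₁ : 𝓞 k) := prime_natCast_of_mod_three hq₁ (by omega)
  have hp₂ : Prime (q₂ : 𝓞 k) := prime_natCast_of_mod_three hq₂ (by omega)
  have hc₁ := card_quotient_natCast_mod_nine (k := k) h₁
  have hc₂ := card_quotient_natCast_mod_nine (k := k) h₂
  refine isThreePrimeRadicand_of_eq_mul (a₀ := 2 * e) (a₁ := f₁) (a₂ := f₂) (π₀ := 1 - ω)
    (((hω.isUnit (by norm_num)).pow 2).neg.pow e) (prime_one_sub hω) hp₁ hp₂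
    (not_associated_one_sub_of_card hω hp₁ hc₁) (not_associated_one_sub_of_card hω hp₂ hc₂)
    (not_associated_natCast hq₁ hq₂ hne hp₁ dvd_rfl dvd_rfl) (Or.inl (Associated.refl _))
    hc₁ hc₂ (by omega) (by omega) (by omega) ?_ (Or.inl (Associated.refl _))
  push_cast
  rw [three_eq_mul_sq hω, mul_pow _ ((1 - ω) ^ 2), ← pow_mul]
  ring

lemma isThreePrimeRadicand_mul_mul (hω : IsPrimitiveRoot ω 3) {q₁ q₂ q₃ f₁ f₂ f₃ : ℕ}
    (hq₁ : q₁.Prime) (hq₂ : q₂.Prime) (hq₃ : q₃.Prime) (h₁₂ : q₁ ≠ q₂) (h₁₃ : q₁ ≠ q₃)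
    (h₂₃ : q₂ ≠ q₃) (h₁ : q₁ % 9 = 8) (h₂ : q₂ % 9 = 8) (h₃ : q₃ % 9 = 8)
    (hf₁ : f₁ = 1 ∨ f₁ = 2) (hf₂ : f₂ = 1 ∨ f₂ = 2) (hf₃ : f₃ = 1 ∨ f₃ = 2)
    (hd : (q₁ ^ f₁ * q₂ ^ f₂ * q₃ ^ f₃) % 9 = 1 ∨ (q₁ ^ f₁ * q₂ ^ f₂ * q₃ ^ f₃) % 9 = 8) :
    IsThreePrimeRadicand ω ((q₁ ^ f₁ * q₂ ^ f₂ * q₃ ^ f₃ : ℕ) : 𝓞 k) := by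
  have hp₁ : Prime (q₁ : 𝓞 k) := prime_natCast_of_mod_three hq₁ (by omega)
  have hp₂ : Prime (q₂ : 𝓞 k) := prime_natCast_of_mod_three hq₂ (by omega)
  exact isThreePrimeRadicand_of_eq_mul (a₀ := f₁) (a₁ := f₂) (a₂ := f₃) isUnit_one hp₁ hp₂
    (prime_natCast_of_mod_three hq₃ (by omega))
    (not_associated_natCast hq₁ hq₂ h₁₂ hp₁ dvd_rfl dvd_rfl)
    (not_associated_natCast hq₁ hq₃ h₁₃ hp₁ dvd_rfl dvd_rfl)
    (not_associated_natCast hq₂ hq₃ h₂₃ hp₂ dvd_rfl dvd_rfl)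
    (Or.inr (card_quotient_natCast_mod_nine h₁)) (card_quotient_natCast_mod_nine h₂)
    (card_quotient_natCast_mod_nine h₃) (by omega) (by omega) (by omega) (by push_cast; ring)
    (Or.inr (exists_dvd_sub_pow_three hω hd))

end Radicands

lemma zetaK_isPrimitiveRoot (d : ℕ) : IsPrimitiveRoot (zetaK d) 3 :=
  IsPrimitiveRoot.of_map_of_injective (f := (Kc d).val) zeta3_isPrimitiveRoot
    (Kc d).val.injective

instance (d : ℕ) : IsCyclotomicExtension {3} ℚ (k0S d) :=
  IsPrimitiveRoot.intermediateField_adjoin_isCyclotomicExtension (K := ℚ) (L := Kc d)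
    (zetaK_isPrimitiveRoot d)

lemma cbrtK_pow_three (d : ℕ) : cbrtK d ^ 3 = d :=
  Subtype.ext (cbrt_pow_three d)

lemma adjoin_cbrtK_eq_top (d : ℕ) : (k0S d)⟮cbrtK d⟯ = ⊤ := by
  let M : IntermediateField ℚ (Kc d) := (k0S d)⟮cbrtK d⟯.restrictScalars ℚ
  have h1 : cbrtK d ∈ M := mem_adjoin_simple_self _ _
  have h2 : zetaK d ∈ M := (k0S d)⟮cbrtK d⟯.algebraMap_mem (zetaK0 d)
  have hM : Kc d ≤ M.map (Kc d).val := by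
    refine adjoin_le_iff.mpr ?_
    rintro _ (rfl | rfl)
    exacts [⟨cbrtK d, h1, rfl⟩, ⟨zetaK d, h2, rfl⟩]
  refine eq_top_iff.mpr fun x _ ↦ ?_
  obtain ⟨y, hy, hyx⟩ := hM x.2
  obtain rfl : y = x := Subtype.ext hyx
  exact hy

/-- A nontrivial automorphism of `ℚ(∛d, ζ₃)` over `ℚ(ζ₃)` multiplies `∛d` by a primitive cube root
of unity. -/
lemma exists_apply_cbrtK_eq {d : ℕ} (hd : d ≠ 0) {σ : Kc d ≃ₐ[k0S d] Kc d} (hσ : σ ≠ 1) :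
    ∃ ω : 𝓞 (k0S d), IsPrimitiveRoot ω 3 ∧
      σ (cbrtK d) = algebraMap (k0S d) (Kc d) ω * cbrtK d := by
  have h0 : cbrtK d ≠ 0 := by
    intro h
    have := cbrtK_pow_three d
    rw [h, zero_pow (by norm_num)] at this
    exact hd (by exact_mod_cast this.symm)
  have hz0 : IsPrimitiveRoot (zetaK0 d) 3 :=
    IsPrimitiveRoot.of_map_of_injective (f := algebraMap (k0S d) (Kc d)) (zetaK_isPrimitiveRoot d)
      (algebraMap (k0S d) (Kc d)).injective
  have hr : (σ (cbrtK d) / cbrtK d) ^ 3 = 1 := by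
    rw [div_pow, ← map_pow, cbrtK_pow_three, map_natCast, div_self (by exact_mod_cast hd)]
  obtain ⟨i, -, hi⟩ := (zetaK_isPrimitiveRoot d).eq_pow_of_pow_eq_one hr
  have hσθ : σ (cbrtK d) = zetaK d ^ i * cbrtK d := by rw [hi, div_mul_cancel₀ _ h0]
  refine ⟨hz0.toInteger ^ i, ?_, hσθ⟩
  refine hz0.toInteger_isPrimitiveRoot.pow_of_coprime i
    ((Nat.prime_three.coprime_iff_not_dvd.mpr fun ⟨j, hj⟩ ↦ hσ ?_).symm)
  rw [hj, pow_mul, (zetaK_isPrimitiveRoot d).pow_eq_one, one_pow, one_mul] at hσθ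
  have : (σ : Kc d →ₐ[k0S d] Kc d) = AlgHom.id _ _ := by
    refine AlgHom.ext_of_adjoin_eq_top (s := {cbrtK d}) ?_ ?_
    · rw [← adjoin_simple_toSubalgebra_of_isAlgebraic (Algebra.IsAlgebraic.isAlgebraic _),
        adjoin_cbrtK_eq_top, top_toSubalgebra]
    · rintro _ rfl
      exact hσθ
  exact AlgEquiv.ext fun x ↦ DFunLike.congr_fun this x

theorem rank_ambiguousClassGroup_eq_two {d : ℕ} (hd : d ≠ 0)
    (hrad : ∀ ω : 𝓞 (k0S d), IsPrimitiveRoot ω 3 → IsThreePrimeRadicand ω (d : 𝓞 (k0S d)))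
    (σ : Kc d ≃ₐ[ℚ] Kc d) (hσfix : ∀ x : Kc d, x ∈ k0S d → σ x = x) (hσne : σ ≠ 1) :
    Group.rank (ambiguousClassGroup d σ) = 2 := by
  let τ : Kc d ≃ₐ[k0S d] Kc d := { σ with commutes' := fun x ↦ hσfix _ x.2 }
  have hτ : τ ≠ 1 := fun h ↦ hσne (AlgEquiv.ext fun x ↦ DFunLike.congr_fun h x)
  obtain ⟨ω, hω, hωτ⟩ := exists_apply_cbrtK_eq hd hτ
  obtain ⟨π, u, a, hπ, hassoc, hπ', ha, hD, hram⟩ := hrad ω hω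
  have h_int : IsIntegral ℤ (cbrtK d ^ 3) := by
    rw [cbrtK_pow_three]
    exact map_natCast (algebraMap ℤ (Kc d)) d ▸ isIntegral_algebraMap
  let θ : 𝓞 (Kc d) := ⟨cbrtK d, h_int.of_pow (by norm_num)⟩
  have hθ : θ ^ 3 = algebraMap (𝓞 (k0S d)) (𝓞 (Kc d)) d := by
    rw [map_natCast]
    refine RingOfIntegers.ext ?_
    simp only [map_pow, map_natCast]
    exact cbrtK_pow_three d
  obtain ⟨P, hP⟩ := exists_isCubicExtensionRamifiedAtThreePrimes hω hθ (adjoin_cbrtK_eq_top d)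
    hωτ hπ hassoc hπ' u ha hD hram
  obtain ⟨D, hDmem, hD9, hD3⟩ := hP.exists_subgroup_classGroup
  have hset : ambiguousSet d σ = D := Set.ext fun c ↦ (hDmem c).symm
  have hgroup : ambiguousClassGroup d σ = D := by
    rw [ambiguousClassGroup, hset, Subgroup.closure_eq, inf_eq_right]
    exact fun c hc ↦ (CommGroup.mem_primaryComponent).mpr ⟨1, by simpa using hD3 c hc⟩
  rw [hgroup]
  exact Group.rank_eq_two_of_card_eq_nine hD9 fun x ↦ Subtype.ext (hD3 x x.2)

/-- For the listed forms of the radicand `d`, the ambiguous `3`-class group of `k/k₀` has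
rank `2`. -/
theorem rank_two_cases
    (d : ℕ) (hd : 1 < d) (hdcf : IsCubeFree d)
    (hform :
      ((∃ p e e₁ : ℕ, p.Prime ∧ p % 9 = 1 ∧ (e = 1 ∨ e = 2) ∧ (e₁ = 1 ∨ e₁ = 2) ∧
        d = 3 ^ e * p ^ e₁) ∨
      (∃ p q e₁ f₁ : ℕ, p.Prime ∧ q.Prime ∧ p % 9 = 1 ∧ q % 9 = 8 ∧
        (e₁ = 1 ∨ e₁ = 2) ∧ (f₁ = 1 ∨ f₁ = 2) ∧ d = p ^ e₁ * q ^ f₁ ∧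
        (d % 9 = 1 ∨ d % 9 = 8)) ∨
      (∃ q₁ q₂ e f₁ f₂ : ℕ, q₁.Prime ∧ q₂.Prime ∧ q₁ ≠ q₂ ∧ q₁ % 9 = 8 ∧ q₂ % 9 = 8 ∧
        (e = 1 ∨ e = 2) ∧ (f₁ = 1 ∨ f₁ = 2) ∧ (f₂ = 1 ∨ f₂ = 2) ∧
        d = 3 ^ e * q₁ ^ f₁ * q₂ ^ f₂) ∨
      (∃ q₁ q₂ q₃ f₁ f₂ f₃ : ℕ, q₁.Prime ∧ q₂.Prime ∧ q₃.Prime ∧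
        q₁ ≠ q₂ ∧ q₁ ≠ q₃ ∧ q₂ ≠ q₃ ∧ q₁ % 9 = 8 ∧ q₂ % 9 = 8 ∧ q₃ % 9 = 8 ∧
        (f₁ = 1 ∨ f₁ = 2) ∧ (f₂ = 1 ∨ f₂ = 2) ∧ (f₃ = 1 ∨ f₃ = 2) ∧
        d = q₁ ^ f₁ * q₂ ^ f₂ * q₃ ^ f₃ ∧ (d % 9 = 1 ∨ d % 9 = 8))))
    (σ : ↥(Kc d) ≃ₐ[ℚ] ↥(Kc d)) (hσfix : ∀ x : ↥(Kc d), x ∈ k0S d → σ x = x)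
    (hσne : σ ≠ 1) :
    Group.rank ↥(ambiguousClassGroup d σ) = 2 := by
  have hd0 : d ≠ 0 := by omega
  refine rank_ambiguousClassGroup_eq_two hd0 (fun ω hω ↦ ?_) σ hσfix hσne
  rcases hform with ⟨p, e, e₁, hp, hp1, he, he₁, rfl⟩ |
    ⟨p, q, e₁, f₁, hp, hq, hp1, hq8, he₁, hf₁, rfl, hd9⟩ |
    ⟨q₁, q₂, e, f₁, f₂, hq₁, hq₂, hne, h₁, h₂, he, hf₁, hf₂, rfl⟩ |
    ⟨q₁, q₂, q₃, f₁, f₂, f₃, hq₁, hq₂, hq₃, h₁₂, h₁₃, h₂₃, h₁, h₂, h₃, hf₁, hf₂, hf₃, rfl, hd9⟩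
  · exact isThreePrimeRadicand_three_mul hω hp hp1 he he₁
  · exact isThreePrimeRadicand_mul hω hp hq hp1 hq8 he₁ hf₁ hd9
  · exact isThreePrimeRadicand_three_mul_mul hω hq₁ hq₂ hne h₁ h₂ he hf₁ hf₂
  · exact isThreePrimeRadicand_mul_mul hω hq₁ hq₂ hq₃ h₁₂ h₁₃ h₂₃ h₁ h₂ h₃ hf₁ hf₂ hf₃ hd9

end
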